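/- arXiv:2008.09294 — 2 statements merged into one kernel-verified Lean document; each statement's English description precedes it below -/
import Mathlib

section
/- Let G be a non-degenerate edge-colored complete graph K_n (n ≥ 4) containing no monochromatic triangle. Then every vertex of G lies on properly colored cycles of every length from 4 to n, unless n = 5 and G is a K_5 whose edge set is the disjoint union of two monochromatic pentagons (each 5-cycle entirely in one color). -/
/-- An edge-colored graph (with total symmetric coloring `col`) contains a
monochromatic triangle. -/
def HasMonoTriangle {V : Type*} (col : V → V → ℕ) : Prop :=
  ∃ x y z : V, x ≠ y ∧ y ≠ z ∧ x ≠ z ∧ col x y = col y z ∧ col x y = col x z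

/-- `c : ZMod ℓ → V` is a properly colored cycle of length `ℓ` in the
edge-colored complete graph with coloring `col`. -/
def IsPCCycle {V : Type*} {ℓ : ℕ} (col : V → V → ℕ) (c : ZMod ℓ → V) : Prop :=
  Function.Injective c ∧
    ∀ i : ZMod ℓ, col (c i) (c (i + 1)) ≠ col (c (i + 1)) (c (i + 2))

/-- There is a properly colored cycle of length `ℓ` through `v`. -/
def PCThrough {V : Type*} (col : V → V → ℕ) (ℓ : ℕ) (v : V) : Prop :=
  ∃ c : ZMod ℓ → V, IsPCCycle col c ∧ ∃ i, c i = v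

/-- `S` is a degenerate set of the edge-colored complete graph `col`. -/
def DegenSet {V : Type*} (col : V → V → ℕ) (S : Set V) : Prop :=
  S.Nonempty ∧ ∃ f : V → ℕ,
    (∀ u ∈ S, ∀ v ∈ S, u ≠ v → col u v = f u ∨ col u v = f v) ∧
    (∀ u ∈ S, ∀ v, v ∉ S → col u v = f u)

/-- A properly colored cycle of length `k`, written as a `k`-periodic sequence indexed by `ℤ`. -/
def IsPeriodicPC {V : Type*} (col : V → V → ℕ) (k : ℕ) (C : ℤ → V) : Prop :=
  (∀ i j, C i = C j ↔ (k : ℤ) ∣ i - j) ∧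
    ∀ i, col (C i) (C (i + 1)) ≠ col (C (i + 1)) (C (i + 2))

/-- Some properly colored cycle of length `k` passes through `v`. -/
def HasPCThrough {V : Type*} (col : V → V → ℕ) (k : ℕ) (v : V) : Prop :=
  ∃ C : ℤ → V, IsPeriodicPC col k C ∧ ∃ i, C i = v

section
variable {V : Type*} {col : V → V → ℕ} {k : ℕ} {C : ℤ → V} {v w w' : V}

theorem col_ne_of_not_mono (hmono : ¬ HasMonoTriangle col) {x y z : V} (hxy : x ≠ y)
    (hyz : y ≠ z) (hxz : x ≠ z) (h : col x y = col x z) : col x y ≠ col y z :=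
  fun h' => hmono ⟨x, y, z, hxy, hyz, hxz, h', h⟩

theorem forall_of_periodic {Q : ℤ → Prop} (hk : 0 < k) (hper : ∀ i, Q (i + k) → Q i)
    (hstep : ∀ i, Q i → Q (i + 1)) {i : ℤ} (hi : Q i) (j : ℤ) : Q j := by
  have up (n : ℕ) : Q (i + n) := by
    induction n with
    | zero => simpa using hi
    | succ n ih => simpa [add_assoc] using hstep _ ih
  have down (n : ℕ) (m : ℤ) (h : Q (m + n * k)) : Q m := by
    induction n with
    | zero => simpa using h
    | succ n ih => exact ih (hper _ (by convert h using 1; push_cast; ring))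
  refine down (i - j).toNat j ?_
  have h1 : (0 : ℤ) ≤ j + (i - j).toNat * k - i := by
    have : ((i - j).toNat : ℤ) ≤ (i - j).toNat * k := le_mul_of_one_le_right (by omega) (by omega)
    omega
  convert up (j + (i - j).toNat * k - i).toNat using 1
  rw [Int.toNat_of_nonneg h1]
  ring

theorem emod_add_one_cases (i : ℤ) {l : ℤ} (hl : 0 < l) :
    (i % l + 1 < l ∧ (i + 1) % l = i % l + 1) ∨ (i % l + 1 = l ∧ (i + 1) % l = 0) := by
  have h0 := Int.emod_nonneg i hl.ne'
  have h1 := Int.emod_lt_of_pos i hl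
  have h2 : (i + 1) % l = (i % l + 1) % l := by simp
  rcases lt_or_eq_of_le (Int.add_one_le_iff.mpr h1) with h | h
  · exact Or.inl ⟨h, by rw [h2, Int.emod_eq_of_lt (by omega) h]⟩
  · exact Or.inr ⟨h, by rw [h2, h, Int.emod_self]⟩

theorem isPeriodicPC_emod {l : ℕ} (hl : 3 ≤ l) (d : ℤ → V)
    (inj : ∀ i j : ℤ, 0 ≤ i → i < l → 0 ≤ j → j < l → d i = d j → i = j)
    (inner : ∀ i : ℤ, 0 ≤ i → i + 2 < l →
      col (d i) (d (i + 1)) ≠ col (d (i + 1)) (d (i + 2)))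
    (wrap₁ : col (d (l - 2)) (d (l - 1)) ≠ col (d (l - 1)) (d 0))
    (wrap₂ : col (d (l - 1)) (d 0) ≠ col (d 0) (d 1)) :
    IsPeriodicPC col l fun i => d (i % l) := by
  have hl0 : (0 : ℤ) < l := by omega
  refine ⟨fun i j => ?_, fun i => ?_⟩
  · rw [Int.dvd_iff_emod_eq_zero, ← Int.emod_eq_emod_iff_emod_sub_eq_zero]
    exact ⟨inj _ _ (Int.emod_nonneg _ hl0.ne') (Int.emod_lt_of_pos _ hl0)
      (Int.emod_nonneg _ hl0.ne') (Int.emod_lt_of_pos _ hl0), congrArg d⟩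
  · have h0 := Int.emod_nonneg i hl0.ne'
    have a := emod_add_one_cases i hl0
    have b := emod_add_one_cases (i + 1) hl0
    rw [show i + 1 + 1 = i + 2 by ring] at b
    dsimp only
    rcases a with ⟨a, a'⟩ | ⟨a, a'⟩ <;> rcases b with ⟨b, b'⟩ | ⟨b, b'⟩ <;> rw [b', a'] <;>
      rw [a'] at b
    · rw [add_assoc]; exact inner _ h0 (by omega)
    · rw [show i % l = l - 2 by omega, show (l : ℤ) - 2 + 1 = l - 1 by ring]; exact wrap₁
    · rw [show i % l = l - 1 by omega]; exact wrap₂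
    · omega

theorem hasPCThrough_of_seq {l : ℕ} (hl : 3 ≤ l) (d : ℤ → V)
    (inj : ∀ i j : ℤ, 0 ≤ i → i < l → 0 ≤ j → j < l → d i = d j → i = j)
    (inner : ∀ i : ℤ, 0 ≤ i → i + 2 < l →
      col (d i) (d (i + 1)) ≠ col (d (i + 1)) (d (i + 2)))
    (wrap₁ : col (d (l - 2)) (d (l - 1)) ≠ col (d (l - 1)) (d 0))
    (wrap₂ : col (d (l - 1)) (d 0) ≠ col (d 0) (d 1))
    (hv : ∃ i : ℤ, 0 ≤ i ∧ i < l ∧ d i = v) : HasPCThrough col l v := by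
  obtain ⟨i, h0, h1, rfl⟩ := hv
  exact ⟨_, isPeriodicPC_emod hl d inj inner wrap₁ wrap₂, i, by rw [Int.emod_eq_of_lt h0 h1]⟩

theorem HasPCThrough.pcThrough (hk : 2 ≤ k) (h : HasPCThrough col k v) : PCThrough col k v := by
  obtain ⟨C, ⟨hC, hp⟩, m, rfl⟩ := h
  have : NeZero k := ⟨by omega⟩
  have key (z : ZMod k) (m : ℤ) (h : z = m) : C z.cast = C m := by
    rw [hC, ← ZMod.intCast_eq_intCast_iff_dvd_sub]
    simp [h]
  refine ⟨fun z => C z.cast, ⟨fun x y h => ?_, fun i => ?_⟩, (m : ZMod k), key _ _ rfl⟩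
  · have := (ZMod.intCast_eq_intCast_iff_dvd_sub _ _ _).2 ((hC _ _).1 h)
    simpa using this.symm
  · dsimp only
    rw [key (i + 1) (i.cast + 1) (by simp), key (i + 2) (i.cast + 2) (by simp)]
    exact hp _

namespace IsPeriodicPC

theorem injOn (h : IsPeriodicPC col k C) {i j : ℤ} (hi : 0 ≤ i) (hi' : i < k) (hj : 0 ≤ j)
    (hj' : j < k) (hij : C i = C j) : i = j := by
  have := Int.eq_zero_of_abs_lt_dvd ((h.1 i j).1 hij) (by rw [abs_lt]; constructor <;> omega)
  omega

theorem add_period (h : IsPeriodicPC col k C) (i : ℤ) : C (i + k) = C i :=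
  (h.1 _ _).2 (by simp)

theorem shift (h : IsPeriodicPC col k C) (s : ℤ) : IsPeriodicPC col k fun i => C (s + i) :=
  ⟨fun i j => by rw [h.1]; ring_nf, fun i => by simpa only [add_assoc] using h.2 (s + i)⟩

theorem exists_rep (h : IsPeriodicPC col k C) (hk : 0 < k) (m : ℤ) :
    ∃ i : ℤ, 0 ≤ i ∧ i < k ∧ C i = C m :=
  ⟨m % k, Int.emod_nonneg _ (by omega), Int.emod_lt_of_pos _ (by omega),
    (h.1 _ _).2 (by rw [← dvd_neg, neg_sub]; exact Int.dvd_self_sub_emod)⟩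

theorem next (h : IsPeriodicPC col k C) (x y z : ℤ) (hy : y = x + 1) (hz : z = x + 2) :
    col (C x) (C y) ≠ col (C y) (C z) := by
  subst hy hz; exact h.2 x

theorem prev (hsym : ∀ u v, col u v = col v u) (h : IsPeriodicPC col k C) (x y z : ℤ)
    (hy : y = x - 1) (hz : z = x - 2) : col (C x) (C y) ≠ col (C y) (C z) := by
  have := h.next z y x (by omega) (by omega)
  rw [hsym (C z) (C y), hsym (C y) (C x)] at this
  exact this.symm

theorem reverse (hsym : ∀ u v, col u v = col v u) (h : IsPeriodicPC col k C) :
    IsPeriodicPC col k fun i => C (-i) :=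
  ⟨fun i j => by rw [h.1, ← dvd_neg]; ring_nf,
    fun i => h.prev hsym _ _ _ (by ring) (by ring)⟩

theorem insert_one (h : IsPeriodicPC col k C) (hk : 3 ≤ k) (hw : ∀ i, w ≠ C i)
    (h₁ : col (C (k - 2)) (C (k - 1)) ≠ col (C (k - 1)) w)
    (h₂ : col (C (k - 1)) w ≠ col w (C 0)) (h₃ : col w (C 0) ≠ col (C 0) (C 1))
    (hv : ∃ i, C i = v) : HasPCThrough col (k + 1) v := by
  refine hasPCThrough_of_seq (by omega) (fun i => if i < k then C i else w) ?_ ?_ ?_ ?_ ?_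
  · intro i j hi hi' hj hj'
    have := h.injOn (i := i) (j := j) hi (hj := hj)
    have := hw i
    have := hw j
    push_cast at *
    grind
  · intro i hi hi'
    push_cast at *
    have := h.2 i
    grind
  · push_cast; grind
  · push_cast; grind
  · obtain ⟨m, rfl⟩ := hv
    obtain ⟨i, a, b, c⟩ := h.exists_rep (by omega) m
    exact ⟨i, a, by push_cast; omega, by simp [b, c]⟩

theorem insert_two_drop (h : IsPeriodicPC col k C) (hk : 3 ≤ k) (hw : ∀ i, w ≠ C i)
    (hw' : ∀ i, w' ≠ C i) (hne : w ≠ w')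
    (h₁ : col (C (k - 3)) (C (k - 2)) ≠ col (C (k - 2)) w)
    (h₂ : col (C (k - 2)) w ≠ col w w') (h₃ : col w w' ≠ col w' (C 0))
    (h₄ : col w' (C 0) ≠ col (C 0) (C 1))
    (hv : ∃ i, C i = v) (hv' : C (k - 1) ≠ v) : HasPCThrough col (k + 1) v := by
  refine hasPCThrough_of_seq (by omega)
    (fun i => if i < k - 1 then C i else if i = k - 1 then w else w') ?_ ?_ ?_ ?_ ?_
  · intro i j hi hi' hj hj'
    have := h.injOn (i := i) (j := j) hi (hj := hj)
    have := hw i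
    have := hw j
    have := hw' i
    have := hw' j
    push_cast at *
    grind
  · intro i hi hi'
    push_cast at *
    have := h.2 i
    grind
  · push_cast; grind
  · push_cast; grind
  · obtain ⟨m, rfl⟩ := hv
    obtain ⟨i, a, b, c⟩ := h.exists_rep (by omega) m
    refine ⟨i, a, by push_cast; omega, ?_⟩
    grind

theorem insert_two_arcs_drop (h : IsPeriodicPC col k C) (hsym : ∀ u v, col u v = col v u)
    (hw : ∀ i, w ≠ C i) (hw' : ∀ i, w' ≠ C i) (hne : w ≠ w')
    (hp : ∀ i, col w (C i) = col (C i) (C (i + 1)))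
    (hm : ∀ i, col w' (C i) = col (C (i - 1)) (C i)) {q : ℤ} (hq : 0 ≤ q) (hq' : q + 3 ≤ k)
    (h₁ : col (C q) (C (q + 1)) ≠ col (C (k - 2)) (C (k - 1)))
    (h₂ : col (C q) (C (q + 1)) ≠ col (C (-1)) (C 0))
    (hv : ∃ i, C i = v) (hv' : C (k - 1) ≠ v) : HasPCThrough col (k + 1) v := by
  refine hasPCThrough_of_seq (by omega)
    (fun i => if i = 0 then w else if i ≤ q + 1 then C (q + 1 - i) else
      if i = q + 2 then w' else C (i - 2)) ?_ ?_ ?_ ?_ ?_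
  · intro i j hi hi' hj hj'
    have i1 := h.injOn (i := q + 1 - i) (j := q + 1 - j)
    have i2 := h.injOn (i := i - 2) (j := q + 1 - j)
    have i3 := h.injOn (i := q + 1 - i) (j := j - 2)
    have i4 := h.injOn (i := i - 2) (j := j - 2)
    push_cast at *
    grind
  · intro i hi hi'
    push_cast at *
    have n1 := h.next (i - 2) (i + 1 - 2) (i + 2 - 2)
    have n2 := h.prev hsym (q + 1 - i) (q + 1 - (i + 1)) (q + 1 - (i + 2))
    have n3 := h.prev hsym (q + 1) q (q - 1)
    have n4 := h.next (-1) 0 1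
    have n5 := h.next q (q + 1) (q + 2)
    have := hp q
    have := hm 0
    have := hm (q + 1)
    grind
  · push_cast
    have n1 := h.next (k - 3) (k - 2) (k - 1)
    have := hp (k - 2)
    have := hm (k - 2)
    grind
  · push_cast
    have n3 := h.prev hsym (q + 1) q (q - 1)
    have := hp (k - 2)
    have := hp q
    grind
  · obtain ⟨m, rfl⟩ := hv
    obtain ⟨i, a, b, c⟩ := h.exists_rep (by omega) m
    by_cases hi : i ≤ q
    · exact ⟨q + 1 - i, by omega, by push_cast; omega, by grind⟩
    · have : i ≠ k - 1 := by grind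
      exact ⟨i + 2, by omega, by push_cast; omega, by grind⟩

theorem insert_two_skip (h : IsPeriodicPC col k C) (hsym : ∀ u v, col u v = col v u)
    (hk : 4 ≤ k) (hw : ∀ i, w ≠ C i) (hw' : ∀ i, w' ≠ C i) (hne : w ≠ w')
    (hp : ∀ i, col w (C i) = col (C i) (C (i + 1)))
    (hm : ∀ i, col w' (C i) = col (C (i - 1)) (C i))
    (h₁ : col w w' ≠ col (C (k - 2)) (C (k - 1)))
    (h₂ : col (C (k - 1)) (C 1) ≠ col (C (k - 2)) (C (k - 1)))
    (h₃ : col (C (k - 1)) (C 1) ≠ col (C 1) (C 2))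
    (hv : ∃ i, C i = v) (hv' : C 0 ≠ v) : HasPCThrough col (k + 1) v := by
  refine hasPCThrough_of_seq (by omega)
    (fun i => if i = 0 then w else if i = 1 then w' else if i = 2 then C (k - 1)
      else C (i - 2)) ?_ ?_ ?_ ?_ ?_
  · intro i j hi hi' hj hj'
    have i1 := h.injOn (i := k - 1) (j := j - 2)
    have i2 := h.injOn (i := i - 2) (j := k - 1)
    have i4 := h.injOn (i := i - 2) (j := j - 2)
    push_cast at *
    grind
  · intro i hi hi'
    push_cast at *
    have n1 := h.next (i - 2) (i + 1 - 2) (i + 2 - 2)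
    have := hm (k - 1)
    grind
  · push_cast
    have n1 := h.next (k - 3) (k - 2) (k - 1)
    have := hp (k - 2)
    grind
  · push_cast
    have := hp (k - 2)
    grind
  · obtain ⟨m, rfl⟩ := hv
    obtain ⟨i, a, b, c⟩ := h.exists_rep (by omega) m
    have : i ≠ 0 := by grind
    by_cases hi : i = k - 1
    · exact ⟨2, by omega, by push_cast; omega, by grind⟩
    · exact ⟨i + 2, by omega, by push_cast; omega, by grind⟩

theorem insert_chord (h : IsPeriodicPC col k C) (hsym : ∀ u v, col u v = col v u)
    (hw : ∀ i, w ≠ C i) (hp : ∀ i, col w (C i) = col (C i) (C (i + 1)))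
    {j : ℤ} (hj : 2 ≤ j) (hj' : j + 2 ≤ k)
    (h₁ : col (C 0) (C j) ≠ col (C 0) (C 1)) (h₂ : col (C 0) (C j) ≠ col (C j) (C (j + 1)))
    (h₃ : col (C (j - 1)) (C j) ≠ col (C (k - 1)) (C k))
    (hv : ∃ i, C i = v) : HasPCThrough col (k + 1) v := by
  refine hasPCThrough_of_seq (by omega)
    (fun i => if i = 0 then w else if i ≤ j then C (j - i) else C (i - 1)) ?_ ?_ ?_ ?_ ?_
  · intro x y hi hi' hj hj'
    have i1 := h.injOn (i := j - x) (j := j - y)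
    have i2 := h.injOn (i := x - 1) (j := j - y)
    have i3 := h.injOn (i := j - x) (j := y - 1)
    have i4 := h.injOn (i := x - 1) (j := y - 1)
    push_cast at *
    grind
  · intro i hi hi'
    push_cast at *
    have n1 := h.next (i - 1) (i + 1 - 1) (i + 2 - 1)
    have n2 := h.prev hsym (j - i) (j - (i + 1)) (j - (i + 2))
    have n3 := h.prev hsym j (j - 1) (j - 2)
    have := hp (j - 1)
    grind
  · push_cast
    have n1 := h.next (k - 2) (k - 1) k
    have := hp (k - 1)
    grind
  · push_cast
    have n3 := h.prev hsym j (j - 1) (j - 2)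
    have := hp (k - 1)
    have := hp (j - 1)
    grind
  · obtain ⟨m, rfl⟩ := hv
    obtain ⟨i, a, b, c⟩ := h.exists_rep (by omega) m
    by_cases hi : i < j
    · exact ⟨j - i, by omega, by push_cast; omega, by grind⟩
    · exact ⟨i + 1, by omega, by push_cast; omega, by grind⟩

theorem exchange_chord (h : IsPeriodicPC col k C) (hsym : ∀ u v, col u v = col v u)
    (hw : ∀ i, w ≠ C i) (hp : ∀ i, col w (C i) = col (C i) (C (i + 1)))
    {j : ℤ} (hj : 2 ≤ j) (hj' : j + 2 ≤ k)
    (h₁ : col (C 0) (C j) ≠ col (C 0) (C 1)) (h₂ : col (C 0) (C j) ≠ col (C j) (C (j + 1)))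
    (h₃ : col (C (j - 1)) (C j) = col (C (k - 1)) (C k)) :
    ∃ D, IsPeriodicPC col k D ∧ D 0 = w ∧ (∀ i, 1 ≤ i → i ≤ j - 1 → D i = C (j - 1 - i)) ∧
      ∀ i, j ≤ i → i < k → D i = C i := by
  refine ⟨_, isPeriodicPC_emod (by omega)
    (fun i => if i = 0 then w else if i ≤ j - 1 then C (j - 1 - i) else C i) ?_ ?_ ?_ ?_,
    by simp, fun i h0 h1 => ?_, fun i h0 h1 => ?_⟩
  · intro x y hi hi' hj hj'
    have i1 := h.injOn (i := j - 1 - x) (j := j - 1 - y)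
    have i2 := h.injOn (i := x) (j := j - 1 - y)
    have i3 := h.injOn (i := j - 1 - x) (j := y)
    have i4 := h.injOn (i := x) (j := y)
    grind
  · intro i hi hi'
    have n1 := h.next i (i + 1) (i + 2)
    have n2 := h.prev hsym (j - 1 - i) (j - 1 - (i + 1)) (j - 1 - (i + 2))
    have n3 := h.prev hsym (j - 1) (j - 2) (j - 3)
    have := hp (j - 2)
    grind
  · have n1 := h.next (k - 2) (k - 1) k
    have := hp (k - 1)
    grind
  · have n3 := h.prev hsym (j - 1) (j - 2) (j - 3)
    have n4 := h.prev hsym j (j - 1) (j - 2)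
    have := hp (k - 1)
    have := hp (j - 2)
    grind
  · have := Int.emod_eq_of_lt (show 0 ≤ i by omega) (show i < k by omega)
    grind
  · have := Int.emod_eq_of_lt (show 0 ≤ i by omega) (show i < k by omega)
    grind

theorem ne_of_lt_lt (h : IsPeriodicPC col k C) {i j : ℤ} (h₁ : i < j) (h₂ : j < i + k) :
    C i ≠ C j := fun hij => by
  have := Int.eq_zero_of_abs_lt_dvd ((h.1 i j).1 hij) (by rw [abs_lt]; constructor <;> omega)
  omega

theorem insert_one_at (h : IsPeriodicPC col k C) (hk : 3 ≤ k) (hw : ∀ i, w ≠ C i) (i : ℤ)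
    (h₁ : col (C (i - 1)) (C i) ≠ col (C i) w)
    (h₂ : col (C i) w ≠ col w (C (i + 1)))
    (h₃ : col w (C (i + 1)) ≠ col (C (i + 1)) (C (i + 2)))
    (hv : ∃ i, C i = v) : HasPCThrough col (k + 1) v := by
  have p := h.add_period
  have p0 := p i
  have p1 := p (i - 1)
  refine (h.shift (i + 1)).insert_one hk (fun j => hw _) ?_ ?_ ?_ ?_
  · grind
  · grind
  · grind
  · obtain ⟨m, rfl⟩ := hv
    exact ⟨m - i - 1, by ring_nf⟩

theorem insert_two_drop_at (h : IsPeriodicPC col k C) (hk : 3 ≤ k) (hw : ∀ i, w ≠ C i)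
    (hw' : ∀ i, w' ≠ C i) (hne : w ≠ w') (i : ℤ)
    (h₁ : col (C (i - 2)) (C (i - 1)) ≠ col (C (i - 1)) w)
    (h₂ : col (C (i - 1)) w ≠ col w w') (h₃ : col w w' ≠ col w' (C (i + 1)))
    (h₄ : col w' (C (i + 1)) ≠ col (C (i + 1)) (C (i + 2)))
    (hv : ∃ i, C i = v) (hv' : C i ≠ v) : HasPCThrough col (k + 1) v := by
  have p := h.add_period
  have p0 := p i
  have p1 := p (i - 1)
  have p2 := p (i - 2)
  refine (h.shift (i + 1)).insert_two_drop hk (fun j => hw _) (fun j => hw' _) hne ?_ ?_ ?_ ?_ ?_ ?_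
  · grind
  · grind
  · grind
  · grind
  · obtain ⟨m, rfl⟩ := hv
    exact ⟨m - i - 1, by ring_nf⟩
  · grind

theorem trichotomy (hsym : ∀ u v, col u v = col v u) (hmono : ¬ HasMonoTriangle col)
    (h : IsPeriodicPC col k C) (hk : 3 ≤ k) (hno : ¬ HasPCThrough col (k + 1) v)
    (hv : ∃ i, C i = v) (hw : ∀ i, w ≠ C i) :
    (∀ i, col w (C i) = col (C i) (C (i + 1))) ∨
    (∀ i, col w (C i) = col (C (i - 1)) (C i)) ∨
    ∃ a, ∀ i, col w (C i) = a ∧ a ≠ col (C i) (C (i + 1)) := by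
  have step (i : ℤ) : col w (C i) = col (C (i - 1)) (C i) ∨ col w (C i) = col w (C (i + 1)) ∨
      col w (C (i + 1)) = col (C (i + 1)) (C (i + 2)) := by
    by_contra! hc
    exact hno (h.insert_one_at hk hw i (by grind) (by grind) (by grind) hv)
  have tri (i : ℤ) : col w (C i) = col w (C (i + 1)) → col w (C i) ≠ col (C i) (C (i + 1)) :=
    col_ne_of_not_mono hmono (hw _) (h.ne_of_lt_lt (by omega) (by omega)) (hw _)
  have p := h.add_period
  have hpc := h.2
  have n (i : ℤ) := h.next (i - 1) i (i + 1) (by ring) (by ring)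
  by_cases hP : ∃ i, col w (C i) = col (C i) (C (i + 1))
  · obtain ⟨i, hi⟩ := hP
    refine Or.inl fun j => forall_of_periodic (k := k)
      (Q := fun i => col w (C i) = col (C i) (C (i + 1))) (by omega) ?_ ?_ hi j
    · intro i hi
      have := p i
      have := p (i + 1)
      grind
    · intro i hi
      have := step i
      have := tri i
      have := n i
      grind
  push Not at hP
  by_cases hN : ∃ i, col w (C i) = col (C (i - 1)) (C i)
  · obtain ⟨i, hi⟩ := hN
    refine Or.inr (Or.inl fun j => ?_)
    have := forall_of_periodic (k := k) (i := -i)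
      (Q := fun i => col w (C (-i)) = col (C (-i - 1)) (C (-i))) (by omega) ?_ ?_ (by simpa) (-j)
    · simpa using this
    · intro i hi
      have := p (-(i + k))
      have := p (-(i + k) - 1)
      grind
    · intro i hi
      have := step (-i - 1)
      have := tri (-i - 1)
      have := n (-i)
      grind
  push Not at hN
  refine Or.inr (Or.inr ⟨col w (C 0), fun j => ?_⟩)
  have : col w (C j) = col w (C 0) := by
    refine forall_of_periodic (k := k) (i := 0) (Q := fun i => col w (C i) = col w (C 0))
      (by omega) (fun i hi => by rwa [p] at hi) (fun i hi => ?_) rfl j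
    have := step i
    have := hP (i + 1)
    grind
  exact ⟨this, this ▸ hP j⟩

theorem exists_ne_ne (h : IsPeriodicPC col k C) (hk : 3 ≤ k) (hv : ∃ i, C i = v) :
    ∃ m, C m ≠ v ∧ C (m + 1) ≠ v := by
  obtain ⟨m, rfl⟩ := hv
  exact ⟨m + 1, (h.ne_of_lt_lt (by omega) (by omega)).symm,
    (h.ne_of_lt_lt (by omega) (by omega)).symm⟩

theorem not_constant (hsym : ∀ u v, col u v = col v u) (hmono : ¬ HasMonoTriangle col)
    (hnondeg : ¬ ∃ S : Set V, DegenSet col S)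
    (h : IsPeriodicPC col k C) (hk : 3 ≤ k) (hno : ¬ HasPCThrough col (k + 1) v)
    (hv : ∃ i, C i = v) (hw : ∀ i, w ≠ C i) :
    ¬ ∃ a, ∀ i, col w (C i) = a ∧ a ≠ col (C i) (C (i + 1)) := by
  intro hc
  obtain ⟨m, hm, hm'⟩ := h.exists_ne_ne hk hv
  refine hnondeg ⟨{u | (∀ i, u ≠ C i) ∧ ∃ a, ∀ i, col u (C i) = a ∧ a ≠ col (C i) (C (i + 1))},
    ⟨w, hw, hc⟩, fun u => col u (C 0), ?_, ?_⟩
  · rintro u ⟨hu, a, ha⟩ u' ⟨hu', b, hb⟩ hne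
    by_contra! hcol
    refine hno (h.insert_two_drop_at hk hu hu' hne m ?_ ?_ ?_ ?_ hv hm)
    · have := ha (m - 1)
      have := ha (m - 2)
      grind
    · have := ha (m - 1)
      have := ha 0
      grind
    · have := hb (m + 1)
      have := hb 0
      grind
    · have := hb (m + 1)
      grind
  · rintro u ⟨hu, a, ha⟩ x hx
    by_cases hxC : ∃ i, x = C i
    · obtain ⟨i, rfl⟩ := hxC
      exact (ha i).1.trans (ha 0).1.symm
    push Not at hxC
    have hne : u ≠ x := by rintro rfl; exact hx ⟨hu, a, ha⟩
    by_contra hcol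
    replace hcol : col u x ≠ a := by rwa [← (ha 0).1]
    rcases trichotomy hsym hmono h hk hno hv hxC with t | t | t
    · have key (i : ℤ) (hi : C i ≠ v) : col u x = col (C (i - 1)) (C i) := by
        by_contra hce
        refine hno (h.insert_two_drop_at hk hxC hu hne.symm i ?_ ?_ ?_ ?_ hv hi)
        · have := t (i - 1)
          have := h.2 (i - 2)
          grind
        · have := t (i - 1)
          grind
        · have := ha (i + 1)
          grind
        · have := ha (i + 1)
          grind
      have k1 := key _ hm
      have k2 := key _ hm'
      have := h.2 (m - 1)
      grind
    · have key (i : ℤ) (hi : C i ≠ v) : col u x = col (C i) (C (i + 1)) := by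
        by_contra hce
        refine hno (h.insert_two_drop_at hk hu hxC hne i ?_ ?_ ?_ ?_ hv hi)
        · have := ha (i - 1)
          have := ha (i - 2)
          grind
        · have := ha (i - 1)
          grind
        · have := t (i + 1)
          grind
        · have := t (i + 1)
          have := h.2 i
          grind
      have k1 := key _ hm
      have k2 := key _ hm'
      have := h.2 m
      grind
    · exact hx ⟨hxC, t⟩

theorem exists_rep_add (h : IsPeriodicPC col k C) (hk : 0 < k) (s m : ℤ) :
    ∃ q : ℤ, 0 ≤ q ∧ q < k ∧ ∀ j, C (m + j) = C (s + q + j) :=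
  ⟨(m - s) % k, Int.emod_nonneg _ (by omega), Int.emod_lt_of_pos _ (by omega), fun j =>
    (h.1 _ _).2 (by convert Int.dvd_self_sub_emod (x := m - s) (m := k) using 1; ring)⟩

theorem not_plus_and_minus (hsym : ∀ u v, col u v = col v u) (hmono : ¬ HasMonoTriangle col)
    (h : IsPeriodicPC col k C) (hk : 3 ≤ k) (hno : ¬ HasPCThrough col (k + 1) v)
    (hv : ∃ i, C i = v) (hw : ∀ i, w ≠ C i) (hw' : ∀ i, w' ≠ C i)
    (hp : ∀ i, col w (C i) = col (C i) (C (i + 1)))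
    (hm : ∀ i, col w' (C i) = col (C (i - 1)) (C i)) : False := by
  have hne : w ≠ w' := by
    rintro rfl
    have := h.2 0
    have := hp 1
    have := hm 1
    grind
  obtain ⟨s, hs, hs'⟩ := h.exists_ne_ne hk hv
  have p := h.add_period
  have two (i : ℤ) : col (C i) (C (i + 1)) = col (C (s - 1)) (C s) ∨
      col (C i) (C (i + 1)) = col (C s) (C (s + 1)) := by
    obtain ⟨q, hq, hq', hi⟩ := h.exists_rep_add (by omega) (s + 1) i
    have i0 := hi 0
    have i1 := hi 1
    have p0 := p s
    have p1 := p (s + 1)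
    have p2 := p (s - 1)
    have p3 := p (s - 2)
    by_contra! hc
    by_cases q1 : q = k - 1
    · grind
    by_cases q2 : q = k - 2
    · grind
    refine hno ((h.shift (s + 1)).insert_two_arcs_drop hsym (fun _ => hw _) (fun _ => hw' _)
      hne (fun i => ?_) (fun i => ?_) hq (by omega) ?_ ?_ ?_ ?_)
    · rw [hp]; ring_nf
    · rw [hm]; ring_nf
    · grind
    · grind
    · obtain ⟨m, rfl⟩ := hv
      exact ⟨m - s - 1, by ring_nf⟩
    · grind
  have alt (i : ℤ) : col (C (i + 2)) (C (i + 3)) = col (C i) (C (i + 1)) := by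
    have := two i
    have := two (i + 1)
    have := two (i + 2)
    have := h.2 i
    have := h.2 (i + 1)
    grind
  have hk4 : 4 ≤ k := by
    by_contra hk4
    have := alt 0
    have := h.2 2
    have := p 0
    have := p 1
    grind
  have key (i : ℤ) (hi : C i ≠ v) : col w w' = col (C (i - 2)) (C (i - 1)) := by
    by_contra hc
    have p0 := p i
    have p1 := p (i - 1)
    have p2 := p (i - 2)
    have a1 := alt (i - 1)
    have a2 := alt (i - 2)
    have ne : C (i - 1) ≠ C (i + 1) := h.ne_of_lt_lt (by omega) (by omega)
    have t1 := col_ne_of_not_mono hmono (hw (i - 1)) ne (hw (i + 1))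
    have t2 := col_ne_of_not_mono hmono (hw' (i - 1)) ne (hw' (i + 1))
    have := hp (i - 1)
    have := hp (i + 1)
    have := hm (i - 1)
    have := hm (i + 1)
    refine hno ((h.shift i).insert_two_skip hsym hk4 (fun _ => hw _) (fun _ => hw' _)
      hne (fun i => ?_) (fun i => ?_) ?_ ?_ ?_ ?_ ?_)
    · rw [hp]; ring_nf
    · rw [hm]; ring_nf
    · grind
    · grind
    · grind
    · obtain ⟨m, rfl⟩ := hv
      exact ⟨m - i, by ring_nf⟩
    · simpa using hi
  have := key _ hs
  have := key _ hs'
  have := h.2 (s - 2)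
  grind

theorem exists_plus (hsym : ∀ u v, col u v = col v u) (hmono : ¬ HasMonoTriangle col)
    (hnondeg : ¬ ∃ S : Set V, DegenSet col S)
    (h : IsPeriodicPC col k C) (hk : 3 ≤ k) (hno : ¬ HasPCThrough col (k + 1) v)
    (hv : ∃ i, C i = v) : ∃ D, IsPeriodicPC col k D ∧ (∃ i, D i = v) ∧
      ∀ w, (∀ i, w ≠ D i) → ∀ i, col w (D i) = col (D i) (D (i + 1)) := by
  by_cases hall : ∀ w, (∀ i, w ≠ C i) → ∀ i, col w (C i) = col (C i) (C (i + 1))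
  · exact ⟨C, h, hv, hall⟩
  obtain ⟨w', hw', hn⟩ : ∃ w', (∀ i, w' ≠ C i) ∧ ¬ ∀ i, col w' (C i) = col (C i) (C (i + 1)) := by
    push Not at hall ⊢; exact hall
  have hm := ((h.trichotomy hsym hmono hk hno hv hw').resolve_left hn).resolve_right
    (h.not_constant hsym hmono hnondeg hk hno hv hw')
  refine ⟨fun i => C (-i), h.reverse hsym, ?_, fun w hw i => ?_⟩
  · obtain ⟨i, rfl⟩ := hv
    exact ⟨-i, by simp⟩
  replace hw (i : ℤ) : w ≠ C i := by simpa using hw (-i)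
  rcases h.trichotomy hsym hmono hk hno hv hw with t | t | t
  · exact (h.not_plus_and_minus hsym hmono hk hno hv hw hw' t hm).elim
  · have := t (-i)
    grind
  · exact (h.not_constant hsym hmono hnondeg hk hno hv hw t).elim

end IsPeriodicPC

/-- The chord of the cycle `C` from `C s` to `C (s + j)` differs in color from the cycle edges
that leave its two ends. -/
def IsBadChord (col : V → V → ℕ) (k : ℕ) (C : ℤ → V) (s j : ℤ) : Prop :=
  2 ≤ j ∧ j + 2 ≤ k ∧ col (C s) (C (s + j)) ≠ col (C s) (C (s + 1)) ∧
    col (C s) (C (s + j)) ≠ col (C (s + j)) (C (s + j + 1))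

namespace IsPeriodicPC

theorem isBadChord_symm (hsym : ∀ u v, col u v = col v u) (h : IsPeriodicPC col k C) {s j : ℤ}
    (hb : IsBadChord col k C s j) : IsBadChord col k C (s + j) (k - j) := by
  obtain ⟨h1, h2, h3, h4⟩ := hb
  have p0 := h.add_period s
  have p1 := h.add_period (s + 1)
  refine ⟨by omega, by omega, ?_, ?_⟩ <;> grind

theorem exists_isBadChord (hsym : ∀ u v, col u v = col v u)
    (hnondeg : ¬ ∃ S : Set V, DegenSet col S) (h : IsPeriodicPC col k C) (hk : 0 < k)
    (hp : ∀ w, (∀ i, w ≠ C i) → ∀ i, col w (C i) = col (C i) (C (i + 1)))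
    (hw : ∀ i, w ≠ C i) : ∃ s j, IsBadChord col k C s j := by
  by_contra! hb
  refine hnondeg ⟨Set.range C, ⟨C 0, 0, rfl⟩, fun u => col w u, ?_, ?_⟩
  · rintro _ ⟨s, rfl⟩ _ ⟨t, rfl⟩ hne
    obtain ⟨q, hq, hq', hi⟩ := h.exists_rep_add hk s t
    have i0 := hi 0
    have i1 := hi 1
    have := hp w hw s
    have := hp w hw t
    have p0 := h.add_period s
    by_contra! hc
    by_cases q0 : q = 0
    · grind
    by_cases q1 : q = 1
    · grind
    by_cases q2 : q = k - 1
    · grind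
    refine hb s q ⟨by omega, by omega, ?_, ?_⟩ <;> grind
  · rintro _ ⟨s, rfl⟩ x hx
    have hx (i : ℤ) : x ≠ C i := fun h => hx ⟨i, h.symm⟩
    dsimp only
    rw [hp w hw, ← hp x hx, hsym]

theorem pred_eq_of_isBadChord (hsym : ∀ u v, col u v = col v u) (h : IsPeriodicPC col k C)
    (hno : ¬ HasPCThrough col (k + 1) v) (hv : ∃ i, C i = v)
    (hw : ∀ i, w ≠ C i) (hp : ∀ i, col w (C i) = col (C i) (C (i + 1))) {s j : ℤ}
    (hb : IsBadChord col k C s j) :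
    col (C (s + j - 1)) (C (s + j)) = col (C (s - 1)) (C s) := by
  obtain ⟨h1, h2, h3, h4⟩ := hb
  by_contra hc
  have p0 := h.add_period s
  have p1 := h.add_period (s - 1)
  refine hno ((h.shift s).insert_chord hsym (fun _ => hw _) (fun i => ?_) h1 h2 ?_ ?_ ?_ ?_)
  · rw [hp]; ring_nf
  · grind
  · grind
  · grind
  · obtain ⟨m, rfl⟩ := hv
    exact ⟨m - s, by ring_nf⟩

theorem exchange_chord_at (h : IsPeriodicPC col k C) (hsym : ∀ u v, col u v = col v u)
    (hno : ¬ HasPCThrough col (k + 1) v) (hv : ∃ i, C i = v)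
    (hw : ∀ i, w ≠ C i) (hp : ∀ i, col w (C i) = col (C i) (C (i + 1))) {s j : ℤ}
    (hb : IsBadChord col k C s j) :
    ∃ D, IsPeriodicPC col k D ∧ D 0 = w ∧
      (∀ i, 1 ≤ i → i ≤ j - 1 → D i = C (s + (j - 1 - i))) ∧
      ∀ i, j ≤ i → i < k → D i = C (s + i) := by
  have e := h.pred_eq_of_isBadChord hsym hno hv hw hp hb
  obtain ⟨h1, h2, h3, h4⟩ := hb
  have p0 := h.add_period s
  have p1 := h.add_period (s - 1)
  refine (h.shift s).exchange_chord hsym (fun _ => hw _) (fun i => ?_) h1 h2 ?_ ?_ ?_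
  · rw [hp]; ring_nf
  · grind
  · grind
  · grind

theorem eq_of_isBadChord_of_ne (hsym : ∀ u v, col u v = col v u) (hmono : ¬ HasMonoTriangle col)
    (h : IsPeriodicPC col k C) (hno : ¬ HasPCThrough col (k + 1) v) (hv : ∃ i, C i = v)
    (hp : ∀ w, (∀ i, w ≠ C i) → ∀ i, col w (C i) = col (C i) (C (i + 1)))
    (hw : ∀ i, w ≠ C i) (hw' : ∀ i, w' ≠ C i) {s j : ℤ}
    (hb : IsBadChord col k C s j) (hs : C (s + j - 1) ≠ v) : w = w' := by
  by_contra hne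
  obtain ⟨D, hD, D0, D1, D2⟩ := h.exchange_chord_at hsym hno hv hw (hp w hw) hb
  obtain ⟨h1, h2, h3, h4⟩ := hb
  have hvD : ∃ i, D i = v := by
    obtain ⟨m, rfl⟩ := hv
    obtain ⟨q, hq, hq', hi⟩ := h.exists_rep_add (by omega) s m
    have i0 := hi 0
    by_cases hqj : j ≤ q
    · exact ⟨q, by grind⟩
    · have : q ≠ j - 1 := by grind
      exact ⟨j - 1 - q, by grind⟩
  have hw'D (i : ℤ) : w' ≠ D i := by
    obtain ⟨q, hq, hq', hi⟩ := hD.exists_rep (by omega) i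
    have := hw' (s + q)
    have := hw' (s + (j - 1 - q))
    grind
  have a1 := hp w hw s
  have a2 := hp w' hw' s
  have a3 := hp w' hw' (s + j)
  have d0 := D1 (j - 1)
  have d1 := D2 j
  have d2 := D2 (j + 1)
  have e1 : col (D (j - 2)) (D (j - 1)) = col (C s) (C (s + 1)) := by
    have d3 := D1 (j - 2)
    grind
  rcases hD.trichotomy hsym hmono (by omega) hno hvD hw'D with t | t | ⟨a, t⟩
  · have := t (j - 1)
    grind
  · have := t j
    grind
  · have := t (j - 1)
    have := t (j - 2)
    grind

theorem chord_colors (hsym : ∀ u v, col u v = col v u) (hmono : ¬ HasMonoTriangle col)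
    (h : IsPeriodicPC col k C) (hno : ∀ v, ¬ HasPCThrough col (k + 1) v)
    (hw : ∀ i, w ≠ C i) (hp : ∀ i, col w (C i) = col (C i) (C (i + 1))) {s j : ℤ}
    (hb : IsBadChord col k C s j) :
    col (C s) (C (s + j)) = col (C (s - 1)) (C s) ∧ ∀ m, j + 1 ≤ m → m < k →
      col (C (s + j - 1)) (C (s + m)) = col (C (s + m - 1)) (C (s + m)) := by
  have e := h.pred_eq_of_isBadChord hsym (hno _) ⟨0, rfl⟩ hw hp hb
  obtain ⟨D, hD, D0, D1, D2⟩ := h.exchange_chord_at hsym (hno _) ⟨0, rfl⟩ hw hp hb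
  obtain ⟨h1, h2, h3, h4⟩ := hb
  have hu (i : ℤ) : C (s + j - 1) ≠ D i := by
    obtain ⟨q, hq, hq', hi⟩ := hD.exists_rep (by omega) i
    rw [← hi]
    by_cases hq0 : q = 0
    · rw [hq0, D0]; exact (hw _).symm
    by_cases hqj : q ≤ j - 1
    · rw [D1 q (by omega) hqj]
      exact (h.ne_of_lt_lt (by omega) (by omega)).symm
    · rw [D2 q (by omega) hq']
      exact h.ne_of_lt_lt (by omega) (by omega)
  have d1 := D1 1
  have a := hp (s + j - 2)
  have t : ∀ i, col (C (s + j - 1)) (D i) = col (D (i - 1)) (D i) := by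
    rcases hD.trichotomy hsym hmono (by omega) (hno _) ⟨0, rfl⟩ hu with t | t | ⟨a, t⟩
    · have := t 1
      have := hD.2 0
      grind
    · exact t
    · have := t 1
      have := t 0
      grind
  refine ⟨?_, fun m hm hm' => ?_⟩
  · have := t j
    have d2 := D1 (j - 1)
    have d3 := D2 j
    grind
  · have := t m
    have d2 := D2 m
    have d3 := D2 (m - 1)
    grind

theorem isBadChord_two (hsym : ∀ u v, col u v = col v u) (hmono : ¬ HasMonoTriangle col)
    (h : IsPeriodicPC col k C) (hno : ∀ v, ¬ HasPCThrough col (k + 1) v)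
    (hw : ∀ i, w ≠ C i) (hp : ∀ i, col w (C i) = col (C i) (C (i + 1))) {s j : ℤ}
    (hb : IsBadChord col k C s j) (i : ℤ) : IsBadChord col k C i 2 := by
  have step (s j : ℤ) (hb : IsBadChord col k C s j) : IsBadChord col k C (s + j - 1) 2 := by
    have a := (h.chord_colors hsym hmono hno hw hp hb).2 (j + 1) le_rfl
      (by have := hb.2.1; omega)
    have n1 := h.next (s + j - 1) (s + j) (s + j + 1) (by ring) (by ring)
    have n2 := h.next (s + j) (s + j + 1) (s + j + 2) (by ring) (by ring)
    obtain ⟨h1, h2, h3, h4⟩ := hb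
    refine ⟨le_rfl, by omega, ?_, ?_⟩ <;> grind
  refine forall_of_periodic (Q := fun i => IsBadChord col k C i 2) (k := k)
    (by have := hb.1; have := hb.2.1; omega) (fun i hi => ?_)
    (fun i hi => by convert step i 2 hi using 1; ring) (step s j hb) i
  have p0 := h.add_period i
  have p1 := h.add_period (i + 1)
  have p2 := h.add_period (i + 2)
  have p3 := h.add_period (i + 3)
  obtain ⟨h1, h2, h3, h4⟩ := hi
  refine ⟨le_rfl, by omega, ?_, ?_⟩ <;> grind

theorem eq_four_of_isBadChord (hsym : ∀ u v, col u v = col v u) (hmono : ¬ HasMonoTriangle col)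
    (h : IsPeriodicPC col k C) (hno : ∀ v, ¬ HasPCThrough col (k + 1) v)
    (hw : ∀ i, w ≠ C i) (hp : ∀ i, col w (C i) = col (C i) (C (i + 1))) {s j : ℤ}
    (hb : IsBadChord col k C s j) :
    k = 4 ∧ (∀ i, col (C (i + 1)) (C (i + 2)) = col (C (i - 1)) (C i)) ∧
      ∀ i, col (C i) (C (i + 2)) = col (C (i - 1)) (C i) := by
  have two := h.isBadChord_two hsym hmono hno hw hp hb
  have alt (i : ℤ) : col (C (i + 1)) (C (i + 2)) = col (C (i - 1)) (C i) := by
    have := h.pred_eq_of_isBadChord hsym (hno _) ⟨0, rfl⟩ hw hp (two i)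
    convert this using 3; ring
  have chord (i : ℤ) := h.chord_colors hsym hmono hno hw hp (two i)
  refine ⟨?_, alt, fun i => (chord i).1⟩
  have hk := (two 0).2.1
  by_contra hk4
  by_cases hk5 : k = 5
  · subst hk5
    have := alt 1
    have := alt 3
    have := h.add_period 0
    have := h.add_period 1
    have := h.2 0
    grind
  · have c1 := (chord 1).1
    have c3 := (chord 3).1
    have c5 := (chord 0).2 5 (by norm_num) (by omega)
    have := alt 1
    have := alt 3
    exact hmono ⟨C 1, C 3, C 5, h.ne_of_lt_lt (by omega) (by omega),
      h.ne_of_lt_lt (by omega) (by omega), h.ne_of_lt_lt (by omega) (by omega),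
      by grind, by grind⟩

theorem exists_pentagons (hsym : ∀ u v, col u v = col v u)
    (h : IsPeriodicPC col 4 C) (hw : ∀ i, w ≠ C i)
    (hp : ∀ i, col w (C i) = col (C i) (C (i + 1)))
    (alt : ∀ i, col (C (i + 1)) (C (i + 2)) = col (C (i - 1)) (C i))
    (chord : ∀ i, col (C i) (C (i + 2)) = col (C (i - 1)) (C i))
    (hV : ∀ u, u = w ∨ ∃ i, C i = u) :
    ∃ e : ZMod 5 → V, Function.Bijective e ∧ ∃ a b : ℕ, a ≠ b ∧
      (∀ i, col (e i) (e (i + 1)) = a) ∧ ∀ i, col (e i) (e (i + 2)) = b := by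
  have p0 := h.add_period 0
  have p1 := h.add_period (-1)
  have w0 := hw 0
  have w1 := hw 1
  have w2 := hw 2
  have w3 := hw 3
  have e0 := hp 0
  have e1 := hp 1
  have e2 := hp 2
  have e3 := hp 3
  have a0 := alt 0
  have a1 := alt 1
  have a2 := alt 2
  have c0 := chord 0
  have c1 := chord 1
  have n01 : C 0 ≠ C 1 := h.ne_of_lt_lt (by omega) (by omega)
  have n02 : C 0 ≠ C 2 := h.ne_of_lt_lt (by omega) (by omega)
  have n03 : C 0 ≠ C 3 := h.ne_of_lt_lt (by omega) (by omega)
  have n12 : C 1 ≠ C 2 := h.ne_of_lt_lt (by omega) (by omega)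
  have n13 : C 1 ≠ C 3 := h.ne_of_lt_lt (by omega) (by omega)
  have n23 : C 2 ≠ C 3 := h.ne_of_lt_lt (by omega) (by omega)
  norm_num at p0 p1 e0 e1 e2 e3 a0 a1 a2 c0 c1
  have ne := h.2 0
  norm_num at ne
  refine ⟨(![w, C 0, C 1, C 3, C 2] : Fin 5 → V), ⟨?_, fun u => ?_⟩,
    col (C 0) (C 1), col (C 1) (C 2), ne, ?_, ?_⟩
  · intro (x : Fin 5) (y : Fin 5) hxy
    fin_cases x <;> fin_cases y <;> first | rfl | (exfalso; simp at hxy; grind)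
  · rcases hV u with rfl | ⟨i, rfl⟩
    · exact ⟨(0 : Fin 5), rfl⟩
    · obtain ⟨q, hq, hq', hi⟩ := h.exists_rep (by norm_num) i
      rw [← hi]
      push_cast at hq'
      interval_cases q
      exacts [⟨(1 : Fin 5), rfl⟩, ⟨(2 : Fin 5), rfl⟩, ⟨(4 : Fin 5), rfl⟩, ⟨(3 : Fin 5), rfl⟩]
  · intro (i : Fin 5)
    fin_cases i
    · change col w (C 0) = _; grind
    · change col (C 0) (C 1) = _; grind
    · change col (C 1) (C 3) = _; grind
    · change col (C 3) (C 2) = _; grind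
    · change col (C 2) w = _; grind
  · intro (i : Fin 5)
    fin_cases i
    · change col w (C 1) = _; grind
    · change col (C 0) (C 3) = _; grind
    · change col (C 1) (C 2) = _; grind
    · change col (C 3) w = _; grind
    · change col (C 2) (C 0) = _; grind

theorem exists_not_mem [Fintype V] (h : IsPeriodicPC col k C) (hk : 0 < k)
    (hcard : k < Fintype.card V) : ∃ w, ∀ i, w ≠ C i := by
  by_contra! hc
  refine hcard.not_ge ?_
  rw [← Fintype.card_fin k]
  refine Fintype.card_le_of_surjective (fun i : Fin k => C i) fun w => ?_
  obtain ⟨i, rfl⟩ := hc w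
  obtain ⟨q, hq, hq', hi⟩ := h.exists_rep hk i
  lift q to ℕ using hq
  exact ⟨⟨q, by exact_mod_cast hq'⟩, hi⟩

theorem card_le_succ [Fintype V] (h : IsPeriodicPC col k C) (hk : 0 < k)
    (hV : ∀ u, u = w ∨ ∃ i, C i = u) : Fintype.card V ≤ k + 1 := by
  have := Fintype.card_le_of_surjective
    (fun i : Option (Fin k) => i.elim w fun i => C (i : ℕ)) fun u => ?_
  · simpa using this
  · rcases hV u with rfl | ⟨i, rfl⟩
    · exact ⟨none, rfl⟩
    · obtain ⟨q, hq, hq', hi⟩ := h.exists_rep hk i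
      lift q to ℕ using hq
      exact ⟨some ⟨q, by exact_mod_cast hq'⟩, hi⟩

theorem surjective_of_card_le [Fintype V] (h : IsPeriodicPC col k C)
    (hcard : Fintype.card V ≤ k) : Function.Surjective C := by
  have inj : Function.Injective fun i : Fin k => C (i : ℕ) := fun i j hij =>
    Fin.ext (by exact_mod_cast h.injOn (by omega) (by omega) (by omega) (by omega) hij)
  have hle := Fintype.card_le_of_injective _ inj
  rw [Fintype.card_fin] at hle
  have := ((Fintype.bijective_iff_injective_and_card _).2
    ⟨inj, by rw [Fintype.card_fin]; omega⟩).2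
  intro u
  obtain ⟨i, hi⟩ := this u
  exact ⟨_, hi⟩

end IsPeriodicPC

theorem HasPCThrough.succ_or_pentagons [Fintype V] (hsym : ∀ u v, col u v = col v u)
    (hmono : ¬ HasMonoTriangle col) (hnondeg : ¬ ∃ S : Set V, DegenSet col S)
    (hk : 3 ≤ k) (hcard : k < Fintype.card V) (h : HasPCThrough col k v) :
    HasPCThrough col (k + 1) v ∨ (Fintype.card V = 5 ∧ ∃ e : ZMod 5 → V, Function.Bijective e ∧
      ∃ a b : ℕ, a ≠ b ∧ (∀ i, col (e i) (e (i + 1)) = a) ∧ ∀ i, col (e i) (e (i + 2)) = b) := by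
  refine or_iff_not_imp_left.2 fun hno => ?_
  obtain ⟨C₀, hC₀, hv₀⟩ := h
  obtain ⟨C, hC, hv, hp⟩ := hC₀.exists_plus hsym hmono hnondeg hk hno hv₀
  obtain ⟨w, hw⟩ := hC.exists_not_mem (by omega) hcard
  obtain ⟨s, j, hb⟩ := hC.exists_isBadChord hsym hnondeg (by omega) hp hw
  have huniq (w' : V) (hw' : ∀ i, w' ≠ C i) : w' = w := by
    by_cases hs : C (s + j - 1) = v
    · refine (hC.eq_of_isBadChord_of_ne hsym hmono hno hv hp hw' hw
        (hC.isBadChord_symm hsym hb) ?_)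
      obtain ⟨h1, h2, -⟩ := hb
      rw [← hs]
      exact (hC.ne_of_lt_lt (by omega) (by omega)).symm
    · exact hC.eq_of_isBadChord_of_ne hsym hmono hno hv hp hw' hw hb hs
  have hV (u : V) : u = w ∨ ∃ i, C i = u := by
    by_contra! hu
    exact hu.1 (huniq u fun i => (hu.2 i).symm)
  have hle := hC.card_le_succ (by omega) hV
  have hno' (u : V) : ¬ HasPCThrough col (k + 1) u := fun ⟨D, hD, _⟩ =>
    hno ⟨D, hD, hD.surjective_of_card_le hle v⟩
  obtain ⟨rfl, alt, chord⟩ := hC.eq_four_of_isBadChord hsym hmono hno' hw (hp w hw) hb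
  exact ⟨by omega, hC.exists_pentagons hsym hw (hp w hw) alt chord hV⟩

theorem hasPCThrough_three (hsym : ∀ u v, col u v = col v u) {a b : V} (hva : v ≠ a)
    (hab : a ≠ b) (hvb : v ≠ b) (h₁ : col v a ≠ col a b) (h₂ : col a b ≠ col v b)
    (h₃ : col v a ≠ col v b) : HasPCThrough col 3 v := by
  refine hasPCThrough_of_seq le_rfl (fun i => if i = 0 then v else if i = 1 then a else b)
    ?_ ?_ ?_ ?_ ⟨0, by simp⟩
  · intro i j
    grind
  · intro i
    grind
  · simp; grind
  · simp; grind

theorem hasPCThrough_four (hsym : ∀ u v, col u v = col v u) {a b c : V} (hva : v ≠ a)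
    (hvb : v ≠ b) (hvc : v ≠ c) (hab : a ≠ b) (hac : a ≠ c) (hbc : b ≠ c)
    (h₁ : col v a ≠ col a b) (h₂ : col a b ≠ col b c) (h₃ : col b c ≠ col v c)
    (h₄ : col v a ≠ col v c) : HasPCThrough col 4 v := by
  refine hasPCThrough_of_seq (by norm_num)
    (fun i => if i = 0 then v else if i = 1 then a else if i = 2 then b else c)
    ?_ ?_ ?_ ?_ ⟨0, by simp⟩
  · intro i j
    grind
  · intro i
    grind
  · simp; grind
  · simp; grind

theorem hasPCThrough_three_or_four [Nontrivial V] (hsym : ∀ u v, col u v = col v u)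
    (hmono : ¬ HasMonoTriangle col) (hnondeg : ¬ ∃ S : Set V, DegenSet col S) (v : V) :
    HasPCThrough col 3 v ∨ HasPCThrough col 4 v := by
  by_contra! hno
  obtain ⟨hno3, hno4⟩ := hno
  have gallai (a b : V) (hva : v ≠ a) (hvb : v ≠ b) (hab : a ≠ b) (hne : col v a ≠ col v b) :
      col a b = col v a ∨ col a b = col v b := by
    by_contra! hc
    exact hno3 (hasPCThrough_three hsym hva hab hvb hc.1.symm hc.2 hne)
  have big (a a' b : V) (hva : v ≠ a) (hva' : v ≠ a') (hvb : v ≠ b) (haa' : a ≠ a')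
      (heq : col v a = col v a') (hne : col v a ≠ col v b) : col b a = col v b := by
    have hab : a ≠ b := by rintro rfl; exact hne rfl
    have ha'b : a' ≠ b := by rintro rfl; exact hne heq
    by_contra hc
    have h1 := gallai a b hva hvb hab hne
    have h2 := col_ne_of_not_mono hmono hva' haa'.symm hva heq.symm
    exact hno4 (hasPCThrough_four hsym hva' hva hvb haa'.symm ha'b hab (by grind) (by grind)
      (by grind) (by grind))
  by_cases hS : ∃ b, v ≠ b ∧ ∀ a, v ≠ a → a ≠ b → col v a ≠ col v b
  · refine hnondeg ⟨{b | v ≠ b ∧ ∀ a, v ≠ a → a ≠ b → col v a ≠ col v b}, hS, col v, ?_, ?_⟩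
    · rintro a ⟨hva, ha⟩ b ⟨hvb, hb⟩ hab
      exact gallai a b hva hvb hab (hb a hva hab)
    · rintro b ⟨hvb, hb⟩ a ha
      by_cases hva : v = a
      · rw [← hva, hsym]
      have hab : a ≠ b := by rintro rfl; exact ha ⟨hvb, hb⟩
      obtain ⟨a', hva', haa', heq⟩ : ∃ a', v ≠ a' ∧ a' ≠ a ∧ col v a' = col v a := by
        by_contra! hc
        exact ha ⟨hva, hc⟩
      exact big a a' b hva hva' hvb haa'.symm heq.symm (hb a hva hab)
  · push Not at hS
    obtain ⟨x, hx⟩ := exists_ne v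
    refine hnondeg ⟨{v}, ⟨v, rfl⟩, fun _ => col v x, by simp, ?_⟩
    intro u hu b hb
    obtain rfl : v = u := hu.symm
    have hvb : v ≠ b := fun h => hb h.symm
    by_contra hne
    obtain ⟨a', h1, h2, h3⟩ := hS b hvb
    obtain ⟨x', k1, k2, k3⟩ := hS x hx.symm
    have b1 := big b a' x hvb h1 hx.symm h2.symm h3.symm hne
    have b2 := big x x' b hx.symm k1 hvb k2.symm k3.symm (Ne.symm hne)
    grind

end

/-- In a non-degenerate edge-colored $K_n$ ($n ≥ 4$) with no monochromatic
triangle, every vertex lies on PC cycles of all lengths from 4 to $n$, unless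
$n = 5$ and the coloring consists of two edge-disjoint monochromatic
pentagons. -/
theorem non_degenerate_vertex_pancyclic
    (n : ℕ) (hn : 4 ≤ n) (col : Fin n → Fin n → ℕ)
    (hsym : ∀ u v, col u v = col v u)
    (hmono : ¬ HasMonoTriangle col)
    (hnondeg : ¬ ∃ S : Set (Fin n), DegenSet col S) :
    (∀ v : Fin n, ∀ ℓ : ℕ, 4 ≤ ℓ → ℓ ≤ n → PCThrough col ℓ v) ∨
    (n = 5 ∧ ∃ e : ZMod 5 → Fin n, Function.Bijective e ∧
      ∃ a b : ℕ, a ≠ b ∧ (∀ i, col (e i) (e (i + 1)) = a) ∧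
        (∀ i, col (e i) (e (i + 2)) = b)) := by
  refine or_iff_not_imp_right.2 fun hex v l hl hln => ?_
  have : Nontrivial (Fin n) := Fin.nontrivial_iff_two_le.2 (by omega)
  have succ (k : ℕ) (hk : 3 ≤ k) (hkn : k < n) (h : HasPCThrough col k v) :
      HasPCThrough col (k + 1) v :=
    (h.succ_or_pentagons hsym hmono hnondeg hk (by simpa)).resolve_right (by simpa using hex)
  refine HasPCThrough.pcThrough (by omega) ?_
  induction l, hl using Nat.le_induction with
  | base =>
    rcases hasPCThrough_three_or_four hsym hmono hnondeg v with h | h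
    · exact succ 3 le_rfl (by omega) h
    · exact h
  | succ k hk ih => exact succ k (by omega) (by omega) (ih (by omega))
end

section
/- Let G be an edge-colored complete graph K_n (n ≥ 4) containing no monochromatic triangle. Then at least one of the following holds: (a) every vertex of G is contained in properly colored cycles of every length from 4 to n; (b) G has a degenerate set S ≠ V(G); (c) n = 5 and G is a K_5 composed of two edge-disjoint monochromatic pentagons. -/
/-- A bi-infinite walk that winds around a properly colored cycle of length `L`. -/
structure IsPCRound {V : Type*} (col : V → V → ℕ) (L : ℤ) (c : ℤ → V) : Prop where
  eq_iff : ∀ i j, c i = c j ↔ L ∣ i - j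
  pc : ∀ i, col (c i) (c (i + 1)) ≠ col (c (i + 1)) (c (i + 2))

/-- The values of `q` on `[0, M)` form a properly colored path. -/
structure IsPCPath {V : Type*} (col : V → V → ℕ) (M : ℤ) (q : ℤ → V) : Prop where
  ne : ∀ i j, 0 ≤ i → i < j → j < M → q i ≠ q j
  pc : ∀ i, 0 ≤ i → i + 2 < M → col (q i) (q (i + 1)) ≠ col (q (i + 1)) (q (i + 2))

section

variable {V : Type*} {col : V → V → ℕ}

namespace IsPCPath

lemma snoc {M : ℤ} {q : ℤ → V} (h : IsPCPath col M q) {y : V}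
    (hy : ∀ i, 0 ≤ i → i < M → q i ≠ y)
    (hc : 2 ≤ M → col (q (M - 2)) (q (M - 1)) ≠ col (q (M - 1)) y) :
    IsPCPath col (M + 1) (fun i => if i = M then y else q i) := by
  constructor
  · intro i j hi hij hj
    have h1 : i ≠ M := by omega
    simp only [h1, if_false]
    split_ifs with h2
    · exact hy i hi (by omega)
    · exact h.ne i j hi hij (by omega)
  · intro i hi hiM
    have h1 : i ≠ M := by omega
    have h2 : i + 1 ≠ M := by omega
    simp only [h1, h2, if_false]
    split_ifs with h3
    · have := hc (by omega)
      rwa [show M - 2 = i by omega, show M - 1 = i + 1 by omega] at this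
    · exact h.pc i hi (by omega)

lemma exists_round {M : ℤ} {q : ℤ → V} (h : IsPCPath col M q) (hM : 3 ≤ M)
    (h1 : col (q (M - 2)) (q (M - 1)) ≠ col (q (M - 1)) (q 0))
    (h2 : col (q (M - 1)) (q 0) ≠ col (q 0) (q 1)) :
    ∃ c, IsPCRound col M c ∧ ∀ i, 0 ≤ i → i < M → c i = q i := by
  have hM0 : 0 < M := by omega
  refine ⟨fun i => q (i % M), ⟨fun i j => ?_, fun i => ?_⟩, fun i hi hiM => ?_⟩
  · have a1 := Int.emod_nonneg i hM0.ne'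
    have a2 := Int.emod_lt_of_pos i hM0
    have b1 := Int.emod_nonneg j hM0.ne'
    have b2 := Int.emod_lt_of_pos j hM0
    rw [Int.dvd_iff_emod_eq_zero, ← Int.emod_eq_emod_iff_emod_sub_eq_zero]
    constructor
    · intro he
      rcases lt_trichotomy (i % M) (j % M) with hl | hl | hl
      · exact absurd he (h.ne _ _ a1 hl b2)
      · exact hl
      · exact absurd he.symm (h.ne _ _ b1 hl a2)
    · intro he
      simp only [he]
  · have a1 := Int.emod_nonneg i hM0.ne'
    have a2 := Int.emod_lt_of_pos i hM0
    have e1 : (i + 1) % M = (i % M + 1) % M := by simp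
    have e2 : (i + 2) % M = (i % M + 2) % M := by simp
    simp only [e1, e2]
    generalize i % M = k at *
    rcases (by omega : k + 2 < M ∨ k = M - 2 ∨ k = M - 1) with hk | hk | hk
    · rw [Int.emod_eq_of_lt (by omega) (by omega), Int.emod_eq_of_lt (by omega) hk]
      exact h.pc k a1 hk
    · subst hk
      rw [Int.emod_eq_of_lt (by omega) (by omega)]
      simpa [show M - 2 + 1 = M - 1 by ring] using h1
    · subst hk
      have : (M - 1 + 2) % M = 1 := by
        rw [show M - 1 + 2 = 1 + M by ring, Int.add_emod_right]
        exact Int.emod_eq_of_lt (by omega) (by omega)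
      rw [this]
      simpa using h2
  · simp only [Int.emod_eq_of_lt hi hiM]

/-- Close a properly colored path to a cycle through one further vertex. -/
lemma exists_round_one {M : ℤ} {q : ℤ → V} (h : IsPCPath col M q) (hM : 2 ≤ M) {x : V}
    (hx : ∀ i, 0 ≤ i → i < M → q i ≠ x)
    (h1 : col (q (M - 2)) (q (M - 1)) ≠ col (q (M - 1)) x)
    (h2 : col (q (M - 1)) x ≠ col x (q 0))
    (h3 : col x (q 0) ≠ col (q 0) (q 1)) :
    ∃ c, IsPCRound col (M + 1) c ∧ (∀ i, 0 ≤ i → i < M → c i = q i) ∧ c M = x := by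
  obtain ⟨c, hc, hcq⟩ := (h.snoc hx fun _ => h1).exists_round (by omega)
    (by
      have e1 : M + 1 - 2 = M - 1 := by ring
      have e2 : M + 1 - 1 = M := by ring
      have n1 : M - 1 ≠ M := by omega
      have n2 : (0 : ℤ) ≠ M := by omega
      simpa only [e1, e2, n1, n2, if_true, if_false] using h2)
    (by
      have e2 : M + 1 - 1 = M := by ring
      have n2 : (0 : ℤ) ≠ M := by omega
      have n1 : (1 : ℤ) ≠ M := by omega
      simpa only [e2, n1, n2, if_true, if_false] using h3)
  refine ⟨c, hc, fun i hi hiM => ?_, ?_⟩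
  · rw [hcq i hi (by omega), if_neg (by omega)]
  · rw [hcq M (by omega) (by omega), if_pos rfl]

/-- Close a properly colored path to a cycle through two further vertices. -/
lemma exists_round_two {M : ℤ} {q : ℤ → V} (h : IsPCPath col M q) (hM : 2 ≤ M) {x y : V}
    (hxy : x ≠ y) (hx : ∀ i, 0 ≤ i → i < M → q i ≠ x) (hy : ∀ i, 0 ≤ i → i < M → q i ≠ y)
    (h1 : col (q (M - 2)) (q (M - 1)) ≠ col (q (M - 1)) x)
    (h2 : col (q (M - 1)) x ≠ col x y) (h3 : col x y ≠ col y (q 0))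
    (h4 : col y (q 0) ≠ col (q 0) (q 1)) :
    ∃ c, IsPCRound col (M + 2) c ∧ (∀ i, 0 ≤ i → i < M → c i = q i) ∧
      c M = x ∧ c (M + 1) = y := by
  have e1 : M + 1 - 2 = M - 1 := by ring
  have e2 : M + 1 - 1 = M := by ring
  have n1 : M - 1 ≠ M := by omega
  have n2 : (0 : ℤ) ≠ M := by omega
  have n3 : (1 : ℤ) ≠ M := by omega
  obtain ⟨c, hc, hcq, hcy⟩ := (h.snoc hx fun _ => h1).exists_round_one (x := y) (by omega)
    (by
      intro i hi hiM
      split_ifs with hi'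
      · exact hxy
      · exact hy i hi (by omega))
    (by simpa only [e1, e2, n1, if_true, if_false] using h2)
    (by simpa only [e2, n2, if_true, if_false] using h3)
    (by simpa only [n2, n3, if_false] using h4)
  refine ⟨c, by rwa [show M + 2 = M + 1 + 1 by ring], fun i hi hiM => ?_, ?_, hcy⟩
  · rw [hcq i hi (by omega), if_neg (by omega)]
  · rw [hcq M (by omega) (by omega), if_pos rfl]

/-- A path with one vertex. -/
lemma single (v : V) : IsPCPath col 1 (fun _ => v) :=
  ⟨fun i j _ _ _ => by omega, fun i _ _ => by omega⟩

lemma pair {u v : V} (h : u ≠ v) : IsPCPath col 2 (fun i => if i = 1 then v else u) := by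
  simpa using (single (col := col) u).snoc (y := v) (fun _ _ _ => h) (by omega)

end IsPCPath

namespace IsPCRound

variable {L : ℤ} {c : ℤ → V}

lemma ne (h : IsPCRound col L c) {i j : ℤ} (hij : i < j) (hj : j < i + L) : c i ≠ c j := by
  intro he
  have := (h.eq_iff j i).1 he.symm
  have := Int.le_of_dvd (by omega) this
  omega

lemma periodic (h : IsPCRound col L c) (i : ℤ) : c (i + L) = c i :=
  (h.eq_iff _ _).2 (by simp)

lemma exists_index (h : IsPCRound col L c) (hL : 0 < L) (m i : ℤ) :
    ∃ k, m ≤ k ∧ k < m + L ∧ c k = c i := by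
  refine ⟨m + (i - m) % L, ?_, ?_, (h.eq_iff _ _).2 ?_⟩
  · have := Int.emod_nonneg (i - m) hL.ne'; omega
  · have := Int.emod_lt_of_pos (i - m) hL; omega
  · have := Int.emod_add_mul_ediv (i - m) L
    exact ⟨-((i - m) / L), by linarith⟩

lemma shift (h : IsPCRound col L c) (s : ℤ) : IsPCRound col L (fun i => c (i + s)) := by
  constructor
  · intro i j
    rw [h.eq_iff]; ring_nf
  · intro i
    have := h.pc (i + s)
    rwa [show i + s + 1 = i + 1 + s by ring, show i + s + 2 = i + 2 + s by ring] at this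

lemma reverse (hsym : ∀ u v, col u v = col v u) (h : IsPCRound col L c) :
    IsPCRound col L (fun i => c (-i)) := by
  constructor
  · intro i j
    rw [h.eq_iff, ← dvd_neg]; ring_nf
  · intro i
    have := h.pc (-(i + 2))
    rw [show -(i + 2) + 1 = -(i + 1) by ring, show -(i + 2) + 2 = -i by ring] at this
    rw [hsym (c (-i)), hsym (c (-(i + 1))) (c (-(i + 2)))]
    exact this.symm

lemma segment (h : IsPCRound col L c) (s M : ℤ) (hM : M ≤ L) :
    IsPCPath col M (fun i => c (i + s)) :=
  ⟨fun i j hi hij hj => h.ne (by omega) (by omega), fun i _ _ => (h.shift s).pc i⟩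

/-- The path `c (i + p), …, c i, c (i + r), …, c (i + L - 1)`. -/
lemma crossPath (hsym : ∀ u v, col u v = col v u) (h : IsPCRound col L c) {i r p : ℤ}
    (hp : 0 ≤ p) (hpr : p < r) (h1 : col (c i) (c (i + r)) ≠ col (c i) (c (i + 1)))
    (h2 : col (c i) (c (i + r)) ≠ col (c (i + r)) (c (i + r + 1))) :
    IsPCPath col (p + 1 + (L - r))
      (fun k => if k ≤ p then c (i + p - k) else c (i + r + (k - p - 1))) := by
  constructor
  · intro k l hk hkl hl
    split_ifs
    · exact (h.ne (by omega) (by omega)).symm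
    · exact h.ne (by omega) (by omega)
    · omega
    · exact h.ne (by omega) (by omega)
  · intro k hk hkM
    rcases (by omega : k + 2 ≤ p ∨ k + 1 = p ∨ k = p ∨ p < k) with hc | hc | hc | hc
    · simp only [show k ≤ p by omega, show k + 1 ≤ p by omega, hc, if_true]
      have := (h.reverse hsym).pc (-(i + p - k))
      convert this using 3 <;> ring_nf
    · subst hc
      simp only [show k ≤ k + 1 by omega, show ¬ k + 2 ≤ k + 1 by omega, le_refl,
        if_true, if_false]
      rw [show i + (k + 1) - k = i + 1 by ring, show i + (k + 1) - (k + 1) = i by ring,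
        show i + r + (k + 2 - (k + 1) - 1) = i + r by ring, hsym (c (i + 1))]
      exact h1.symm
    · subst hc
      simp only [show ¬ k + 1 ≤ k by omega, show ¬ k + 2 ≤ k by omega, le_refl,
        if_true, if_false]
      rw [show i + k - k = i by ring, show i + r + (k + 1 - k - 1) = i + r by ring,
        show i + r + (k + 2 - k - 1) = i + r + 1 by ring]
      exact h2
    · simp only [show ¬ k ≤ p by omega, show ¬ k + 1 ≤ p by omega, show ¬ k + 2 ≤ p by omega,
        if_false]
      have := h.pc (i + r + (k - p - 1))
      convert this using 3 <;> ring_nf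

lemma pcThrough {ℓ : ℕ} (h : IsPCRound col (ℓ : ℤ) c) (i : ℤ) : PCThrough col ℓ (c i) := by
  have key : ∀ (z : ZMod ℓ) (k : ℤ), (k : ZMod ℓ) = z → c z.cast = c k := by
    intro z k hk
    rw [h.eq_iff, ← ZMod.intCast_eq_intCast_iff_dvd_sub]
    simp [hk]
  refine ⟨fun z => c z.cast, ⟨fun y z hyz => ?_, fun z => ?_⟩, (i : ZMod ℓ), key _ _ rfl⟩
  · have := (h.eq_iff _ _).1 hyz
    rw [← ZMod.intCast_eq_intCast_iff_dvd_sub] at this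
    simpa using this.symm
  · dsimp only
    rw [key (z + 1) ((z.cast : ℤ) + 1) (by simp), key (z + 2) ((z.cast : ℤ) + 2) (by simp)]
    exact h.pc _

end IsPCRound

/-- `x` sees every vertex of the round in the color of the outgoing edge. -/
def SuccLike (col : V → V → ℕ) (c : ℤ → V) (x : V) : Prop :=
  ∀ i, col (c i) x = col (c i) (c (i + 1))

/-- `x` sees every vertex of the round in the color of the incoming edge. -/
def PredLike (col : V → V → ℕ) (c : ℤ → V) (x : V) : Prop :=
  ∀ i, col (c i) x = col (c i) (c (i - 1))

/-- `x` sees the round in a single color that does not occur on the round. -/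
def ConstLike (col : V → V → ℕ) (c : ℤ → V) (x : V) : Prop :=
  ∃ e, ∀ i, col (c i) x = e ∧ e ≠ col (c i) (c (i + 1))

/-- No properly colored cycle of length `L` passes through `v`. -/
def NoRound (col : V → V → ℕ) (L : ℤ) (v : V) : Prop :=
  ∀ c, IsPCRound col L c → ∀ i, c i ≠ v

lemma SuccLike.reverse {c : ℤ → V} {x : V} (hx : SuccLike col c x) :
    PredLike col (fun i => c (-i)) x := by
  intro i
  have := hx (-i)
  rwa [show -i + 1 = -(i - 1) by ring] at this

lemma PredLike.reverse {c : ℤ → V} {x : V} (hx : PredLike col c x) :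
    SuccLike col (fun i => c (-i)) x := by
  intro i
  have := hx (-i)
  rwa [show -i - 1 = -(i + 1) by ring] at this

lemma ConstLike.reverse (hsym : ∀ u v, col u v = col v u) {c : ℤ → V} {x : V}
    (hx : ConstLike col c x) : ConstLike col (fun i => c (-i)) x := by
  obtain ⟨e, he⟩ := hx
  refine ⟨e, fun i => ⟨(he _).1, ?_⟩⟩
  have := (he (-(i + 1))).2
  rw [show -(i + 1) + 1 = -i by ring, hsym] at this
  exact this

lemma HasMonoTriangle.elim (hmono : ¬ HasMonoTriangle col) {x y z : V} {e : ℕ} (hxy : x ≠ y) (hyz : y ≠ z) (hxz : x ≠ z)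
    (h1 : col x y = e) (h2 : col y z = e) (h3 : col x z = e) : False :=
  hmono ⟨x, y, z, hxy, hyz, hxz, by rw [h1, h2], by rw [h1, h3]⟩

namespace IsPCRound

variable {L : ℤ} {c : ℤ → V} {v x y : V}

lemma ne_succ (h : IsPCRound col L c) (hL : 3 ≤ L) (i : ℤ) : c i ≠ c (i + 1) :=
  h.ne (by omega) (by omega)

lemma pc_pred (hsym : ∀ u v, col u v = col v u) (h : IsPCRound col L c) (i : ℤ) :
    col (c i) (c (i - 1)) ≠ col (c i) (c (i + 1)) := by
  have := h.pc (i - 1)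
  rwa [show i - 1 + 1 = i by ring, show i - 1 + 2 = i + 1 by ring, hsym] at this

lemma not_insert (hsym : ∀ u v, col u v = col v u) (h : IsPCRound col L c) (hL : 3 ≤ L)
    (hno : NoRound col (L + 1) v) {i₀ : ℤ} (hv : c i₀ = v) (hx : ∀ i, c i ≠ x) (i : ℤ) :
    col (c i) x = col (c i) (c (i - 1)) ∨ col (c i) x = col (c (i + 1)) x ∨
      col (c (i + 1)) x = col (c (i + 1)) (c (i + 2)) := by
  by_contra! hc
  obtain ⟨h1, h2, h3⟩ := hc
  have e1 : c (L - 1 + (i + 1)) = c i := by rw [← h.periodic i]; congr 1; ring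
  have e2 : c (L - 2 + (i + 1)) = c (i - 1) := by rw [← h.periodic (i - 1)]; congr 1; ring
  obtain ⟨c', hc', hcq, -⟩ := (h.segment (i + 1) L le_rfl).exists_round_one (by omega)
    (fun k _ _ => hx _)
    (by simp only [e1, e2]; rw [hsym]; exact h1.symm)
    (by simp only [e1, zero_add]; rw [hsym x]; exact h2)
    (by
      simp only [zero_add]
      rw [hsym x, show 1 + (i + 1) = i + 2 by ring]; exact h3)
  obtain ⟨k, hk1, hk2, hk⟩ := h.exists_index (by omega) (i + 1) i₀
  refine hno c' hc' (k - (i + 1)) ?_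
  rw [hcq _ (by omega) (by omega), ← hv, ← hk]
  congr 1; ring

lemma forall_of_step (h : IsPCRound col L c) (hL : 0 < L) {p : V → Prop} {i : ℤ} (hi : p (c i))
    (hp : ∀ i, p (c i) → p (c (i + 1))) (j : ℤ) : p (c j) := by
  obtain ⟨k, hk1, -, hk⟩ := h.exists_index hL i j
  rw [← hk]
  exact Int.leInduction (m := i) (motive := fun k _ => p (c k)) hi (fun k _ => hp k) k hk1

lemma forall_of_forall_range (h : IsPCRound col L c) (hL : 0 < L) {p : V → Prop}
    (hp : ∀ i, 0 ≤ i → i < L → p (c i)) (j : ℤ) : p (c j) := by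
  obtain ⟨k, hk1, hk2, hk⟩ := h.exists_index hL 0 j
  rw [← hk]
  exact hp k hk1 (by omega)

lemma succLike_of_eq (hsym : ∀ u v, col u v = col v u) (hmono : ¬ HasMonoTriangle col)
    (h : IsPCRound col L c) (hL : 3 ≤ L) (hno : NoRound col (L + 1) v) {i₀ : ℤ} (hv : c i₀ = v)
    (hx : ∀ i, c i ≠ x) {i : ℤ} (hi : col (c i) x = col (c i) (c (i + 1))) :
    SuccLike col c x := by
  have step : ∀ i, col (c i) x = col (c i) (c (i + 1)) →
      col (c (i + 1)) x = col (c (i + 1)) (c (i + 2)) := by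
    intro i hi
    rcases h.not_insert hsym hL hno hv hx i with h1 | h1 | h1
    · exact absurd (h1.symm.trans hi) (h.pc_pred hsym i)
    · exact (HasMonoTriangle.elim hmono (h.ne_succ hL i) (hx _) (hx _) hi.symm h1.symm rfl).elim
    · exact h1
  intro j
  obtain ⟨k, hk1, -, hk⟩ := h.exists_index (by omega : 0 < L) i j
  have hk' : c (k + 1) = c (j + 1) := by
    rw [h.eq_iff] at hk ⊢
    convert hk using 1; ring
  rw [← hk, ← hk']
  refine Int.leInduction (m := i)
    (motive := fun k _ => col (c k) x = col (c k) (c (k + 1))) hi (fun k _ hk => ?_) k hk1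
  rw [step k hk, show k + 1 + 1 = k + 2 by ring]

lemma predLike_of_eq (hsym : ∀ u v, col u v = col v u) (hmono : ¬ HasMonoTriangle col)
    (h : IsPCRound col L c) (hL : 3 ≤ L) (hno : NoRound col (L + 1) v) {i₀ : ℤ} (hv : c i₀ = v)
    (hx : ∀ i, c i ≠ x) {i : ℤ} (hi : col (c i) x = col (c i) (c (i - 1))) :
    PredLike col c x := by
  have := ((h.reverse hsym).succLike_of_eq hsym hmono hL hno (i₀ := -i₀) (by simpa using hv)
    (fun i => hx (-i)) (i := -i) (by
      rw [neg_neg, show -(-i + 1) = i - 1 by ring]; exact hi)).reverse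
  simpa using this

lemma trichotomy (hsym : ∀ u v, col u v = col v u) (hmono : ¬ HasMonoTriangle col)
    (h : IsPCRound col L c) (hL : 3 ≤ L) (hno : NoRound col (L + 1) v) {i₀ : ℤ} (hv : c i₀ = v)
    (hx : ∀ i, c i ≠ x) : SuccLike col c x ∨ PredLike col c x ∨ ConstLike col c x := by
  by_cases hN : ∃ i, col (c i) x = col (c i) (c (i + 1))
  · exact .inl (h.succLike_of_eq hsym hmono hL hno hv hx hN.choose_spec)
  by_cases hP : ∃ i, col (c i) x = col (c i) (c (i - 1))
  · exact .inr (.inl (h.predLike_of_eq hsym hmono hL hno hv hx hP.choose_spec))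
  push Not at hN hP
  refine .inr (.inr ⟨col (c 0) x, fun i => ?_⟩)
  have key : col (c i) x = col (c 0) x := by
    refine h.forall_of_step (p := fun u => col u x = col (c 0) x) (by omega) (i := 0) rfl ?_ i
    intro i hi
    rcases h.not_insert hsym hL hno hv hx i with h1 | h1 | h1
    · exact absurd h1 (hP i)
    · exact h1.symm.trans hi
    · exact absurd h1 (by simpa [add_assoc] using hN (i + 1))
  exact ⟨key, by rw [← key]; exact hN i⟩

/-- Two vertices outside a round cannot replace a vertex other than `v`. -/
lemma not_replace (hsym : ∀ u v, col u v = col v u) (h : IsPCRound col L c) (hL : 3 ≤ L)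
    (hno : NoRound col (L + 1) (c 0)) (hxy : x ≠ y) (hx : ∀ i, c i ≠ x) (hy : ∀ i, c i ≠ y)
    {t : ℤ} (ht : 0 < t) (htL : t < L)
    (h1 : col (c (t - 1)) x ≠ col (c (t - 1)) (c (t - 2)))
    (h2 : col (c (t + 1)) y ≠ col (c (t + 1)) (c (t + 2))) :
    col x y = col (c (t - 1)) x ∨ col x y = col (c (t + 1)) y := by
  by_contra! hc
  have e1 : c (L - 1 - 1 + (t + 1)) = c (t - 1) := by rw [← h.periodic (t - 1)]; congr 1; ring
  have e2 : c (L - 1 - 2 + (t + 1)) = c (t - 2) := by rw [← h.periodic (t - 2)]; congr 1; ring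
  obtain ⟨c', hc', hcq, -⟩ := (h.segment (t + 1) (L - 1) (by omega)).exists_round_two
    (by omega) hxy (fun k _ _ => hx _) (fun k _ _ => hy _)
    (by simp only [e1, e2]; rw [hsym]; exact h1.symm)
    (by simp only [e1]; exact hc.1.symm)
    (by simp only [zero_add]; rw [hsym y]; exact hc.2)
    (by
      simp only [zero_add]
      rw [hsym y, show 1 + (t + 1) = t + 2 by ring]; exact h2)
  refine hno c' (by rwa [show L + 1 = L - 1 + 2 by ring]) (L - (t + 1)) ?_
  rw [hcq _ (by omega) (by omega), ← h.periodic 0]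
  congr 1; ring

lemma not_constLike_of_succLike (hsym : ∀ u v, col u v = col v u)
    (h : IsPCRound col L c) (hL : 3 ≤ L)
    (hno : NoRound col (L + 1) (c 0)) (hx : ∀ i, c i ≠ x) (hy : ∀ i, c i ≠ y)
    (hN : SuccLike col c y) (hO : ConstLike col c x) (hxy : y ≠ x) : col x y = col (c 0) x := by
  obtain ⟨e, he⟩ := hO
  have key : ∀ t, 0 < t → t < L → col y x = col (c (t - 1)) (c t) ∨ col y x = e := by
    intro t ht htL
    have := h.not_replace hsym hL hno hxy hy hx ht htL
      (by
        rw [hN]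
        exact (h.pc_pred hsym (t - 1)).symm.trans_eq (by ring_nf))
      (by
        rw [(he _).1]
        have := (he (t + 1)).2
        rwa [show t + 1 + 1 = t + 2 by ring] at this)
    rw [hN, (he _).1, sub_add_cancel] at this
    exact this
  rw [hsym x, (he 0).1]
  rcases key 1 (by omega) (by omega) with h1 | h1
  · rcases key 2 (by omega) (by omega) with h2 | h2
    · exact absurd (h1.symm.trans h2) (h.pc 0)
    · exact h2
  · exact h1

lemma not_constLike (hsym : ∀ u v, col u v = col v u) (hmono : ¬ HasMonoTriangle col)
    (hdeg : ∀ S, DegenSet col S → S = Set.univ) (h : IsPCRound col L c) (hL : 3 ≤ L)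
    (hno : NoRound col (L + 1) (c 0)) (hx : ∀ i, c i ≠ x) : ¬ ConstLike col c x := by
  intro hO
  have hS := hdeg {z | (∀ i, c i ≠ z) ∧ ConstLike col c z} ⟨⟨x, hx, hO⟩, fun z => col (c 0) z, ?_, ?_⟩
  · have : c 0 ∈ {z | (∀ i, c i ≠ z) ∧ ConstLike col c z} := hS ▸ Set.mem_univ _
    exact this.1 0 rfl
  · rintro y ⟨hy, e, he⟩ z ⟨hz, e', he'⟩ hyz
    have := h.not_replace hsym hL hno hyz hy hz (t := 1) (by omega) (by omega)
      (by
        rw [(he _).1]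
        have := (he (-1)).2
        rw [hsym] at this
        simpa using this)
      (by
        rw [(he' _).1]
        simpa using (he' 2).2)
    rwa [(he _).1, (he' _).1, ← (he 0).1, ← (he' 0).1] at this
  · rintro y ⟨hy, hyO⟩ z hz
    by_cases hzc : ∃ i, c i = z
    · obtain ⟨i, rfl⟩ := hzc
      obtain ⟨e, he⟩ := hyO
      rw [hsym, (he i).1]
      exact (he 0).1.symm
    push Not at hzc
    have hyz : z ≠ y := by
      rintro rfl
      exact hz ⟨hy, hyO⟩
    rcases h.trichotomy hsym hmono hL hno rfl hzc with hN | hP | hO'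
    · exact h.not_constLike_of_succLike hsym hL hno hy hzc hN hyO hyz
    · have := (h.reverse hsym).not_constLike_of_succLike hsym hL (by simpa using hno)
        (fun i => hy _) (fun i => hzc _) hP.reverse (hyO.reverse hsym) hyz
      simpa using this
    · exact absurd ⟨hzc, hO'⟩ hz

end IsPCRound

namespace IsPCRound

variable {L : ℤ} {c : ℤ → V} {x y : V}

/-- If `x` and `y` can replace `c (i + 1)` and `c (i + 2)`, then `c (i + 1)` sees the rest of the
round in the colors of the outgoing edges. -/
lemma eq_of_replace_two (hsym : ∀ u v, col u v = col v u) (hmono : ¬ HasMonoTriangle col)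
    (h : IsPCRound col L c) (hL : 4 ≤ L) (hno : NoRound col (L + 1) (c 0)) (hxy : x ≠ y)
    (hx : ∀ i, c i ≠ x) (hy : ∀ i, c i ≠ y) (hN : SuccLike col c x) (hP : PredLike col c y)
    {i : ℤ} (hi : 0 ≤ i) (hiL : i + 2 < L) (h1 : col (c i) (c (i + 1)) ≠ col x y)
    (h2 : col (c (i + 2)) (c (i + 3)) ≠ col x y) {k : ℤ} (hk : i + 3 ≤ k) (hkL : k < i + L) :
    col (c k) (c (i + 1)) = col (c k) (c (k + 1)) := by
  have e1 : c (L - 2 - 1 + (i + 3)) = c i := by rw [← h.periodic i]; congr 1; ring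
  have e2 : c (L - 2 - 2 + (i + 3)) = c (i - 1) := by rw [← h.periodic (i - 1)]; congr 1; ring
  obtain ⟨c', hc', hcq, hcx, hcy⟩ := (h.segment (i + 3) (L - 2) (by omega)).exists_round_two
    (by omega) hxy (fun k _ _ => hx _) (fun k _ _ => hy _)
    (by
      simp only [e1, e2]; rw [hsym, hN i]
      exact h.pc_pred hsym i)
    (by simp only [e1]; rw [hN i]; exact h1)
    (by
      simp only [zero_add]; rw [hsym y, hP, hsym (c (i + 3)), show i + 3 - 1 = i + 2 by ring]
      exact h2.symm)
    (by
      simp only [zero_add]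
      rw [hsym y, hP, show 1 + (i + 3) = i + 3 + 1 by ring]
      exact h.pc_pred hsym (i + 3))
  rw [show L - 2 + 2 = L by ring] at hc'
  have hw : ∀ j, c' j ≠ c (i + 1) := by
    refine hc'.forall_of_forall_range (by omega) (p := fun u => u ≠ c (i + 1)) fun j hj hjL => ?_
    rcases (by omega : j < L - 2 ∨ j = L - 2 ∨ j = L - 2 + 1) with hj' | rfl | rfl
    · rw [hcq j hj hj', ← h.periodic (i + 1)]
      exact h.ne (by omega) (by omega)
    · rw [hcx]; exact (hx _).symm
    · rw [hcy]; exact (hy _).symm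
  have hv : c' (L - (i + 3)) = c 0 := by
    rw [hcq _ (by omega) (by omega), ← h.periodic 0]
    congr 1; ring
  have hN' : SuccLike col c' (c (i + 1)) := by
    refine hc'.succLike_of_eq hsym hmono (by omega) hno hv hw (i := L - 2 - 1) ?_
    rw [hcq _ (by omega) (by omega), e1, sub_add_cancel, hcx, hN]
  have := hN' (k - (i + 3))
  rwa [hcq _ (by omega) (by omega), hcq _ (by omega) (by omega), sub_add_cancel,
    show k - (i + 3) + 1 + (i + 3) = k + 1 by ring] at this

lemma not_succLike_predLike (hsym : ∀ u v, col u v = col v u) (hmono : ¬ HasMonoTriangle col)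
    (h : IsPCRound col L c) (hL : 3 ≤ L) (hno : NoRound col (L + 1) (c 0))
    (hx : ∀ i, c i ≠ x) (hy : ∀ i, c i ≠ y) (hN : SuccLike col c x) (hP : PredLike col c y) :
    False := by
  have hxy : x ≠ y := by
    rintro rfl
    exact h.pc_pred hsym 0 ((hP 0).symm.trans (hN 0))
  have hP' : ∀ i, col (c (i + 1)) y = col (c i) (c (i + 1)) := fun i => by
    rw [hP, hsym, add_sub_cancel_right]
  rcases hL.eq_or_lt with rfl | hL
  · obtain ⟨c', hc', hcq, -⟩ := ((IsPCPath.pair (col := col) (hx 0)).snoc (y := c 1)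
      (by
        intro i _ _
        split_ifs
        · exact (hx 1).symm
        · exact h.ne (by omega) (by omega))
      (by
        intro _
        simp only [show (2 : ℤ) - 2 = 0 by norm_num, show (2 : ℤ) - 1 = 1 by norm_num,
          zero_ne_one, if_true, if_false]
        rw [hsym x, hN, hN]
        exact h.pc 0)).exists_round_one (x := y) (by omega)
      (by
        intro i _ _
        split_ifs
        exacts [hy _, hxy, hy _])
      (by
        norm_num
        rw [hsym x, hN, hP]
        exact (h.pc_pred hsym 1).symm)
      (by
        norm_num
        rw [hsym y, hP, hP, hsym (c 1), sub_self]
        simpa using (h.pc_pred hsym 0).symm)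
      (by
        norm_num
        rw [hsym y, hN, hP]
        exact h.pc_pred hsym 0)
    refine hno c' hc' 0 ?_
    rw [hcq 0 (by omega) (by omega)]
    norm_num
  have key : ∀ t, 0 < t → t < L →
      col x y = col (c (t - 1)) (c t) ∨ col x y = col (c t) (c (t + 1)) := by
    intro t ht htL
    have := h.not_replace hsym (by omega) hno hxy hx hy ht htL
      (by
        rw [hN]
        exact (h.pc_pred hsym (t - 1)).symm.trans_eq (by ring_nf))
      (by
        rw [hP']
        exact h.pc t)
    rwa [hN, hP', sub_add_cancel] at this
  have p0 := h.pc 0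
  have p1 := h.pc 1
  have p2 := h.pc 2
  have k1 := key 1 (by omega) (by omega)
  have k2 := key 2 (by omega) (by omega)
  have k3 := key 3 (by omega) (by omega)
  norm_num at p0 p1 p2 k1 k2 k3
  by_cases hd : col (c 1) (c 2) = col x y
  · have d0 : col (c 0) (c 1) ≠ col x y := fun h => p0 (h.trans hd.symm)
    have d2 : col (c 2) (c 3) ≠ col x y := fun h => p1 (hd.trans h.symm)
    have d3 : col x y = col (c 3) (c 4) := k3.resolve_left (Ne.symm d2)
    have := h.eq_of_replace_two hsym hmono (by omega) hno hxy hx hy hN hP (i := 0) (k := 3)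
      (by omega) (by omega) d0 d2 (by omega) (by omega)
    refine HasMonoTriangle.elim hmono (x := c 3) (y := c 1) (z := x) (e := col x y)
      (h.ne (by omega) (by omega)).symm (hx _) (hx _) (this.trans d3.symm) ?_ ?_
    · rw [hN]; exact hd
    · rw [hN]; exact d3.symm
  · have d0 : col x y = col (c 0) (c 1) := k1.resolve_right (Ne.symm hd)
    have d2 : col x y = col (c 2) (c 3) := k2.resolve_left (Ne.symm hd)
    have d3 : col (c 3) (c 4) ≠ col x y := fun h => p2 (d2.symm.trans h.symm)
    have := h.eq_of_replace_two hsym hmono (by omega) hno hxy hx hy hN hP (i := 1) (k := L)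
      (by omega) (by omega) hd d3 (by omega) (by omega)
    have e0 : c L = c 0 := by simpa using h.periodic 0
    have e1 : c (L + 1) = c 1 := by rw [add_comm]; exact h.periodic 1
    rw [e0, e1] at this
    refine HasMonoTriangle.elim hmono (x := c 0) (y := c 2) (z := x) (e := col x y)
      (h.ne (by omega) (by omega)) (hx _) (hx _) (this.trans d0.symm) ?_ ?_
    · rw [hN]; exact d2.symm
    · rw [hN]; exact d0.symm

/-- Up to reversal, every vertex outside a maximal round is `SuccLike`. -/
lemma exists_forall_succLike (hsym : ∀ u v, col u v = col v u) (hmono : ¬ HasMonoTriangle col)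
    (hdeg : ∀ S, DegenSet col S → S = Set.univ) (h : IsPCRound col L c) (hL : 3 ≤ L)
    (hno : NoRound col (L + 1) (c 0)) :
    ∃ c', IsPCRound col L c' ∧ c' 0 = c 0 ∧ Set.range c' = Set.range c ∧
      ∀ x, (∀ i, c' i ≠ x) → SuccLike col c' x := by
  have tri : ∀ x, (∀ i, c i ≠ x) → SuccLike col c x ∨ PredLike col c x := fun x hx => by
    have := h.trichotomy hsym hmono hL hno rfl hx
    have := h.not_constLike hsym hmono hdeg hL hno hx
    tauto
  by_cases hall : ∀ x, (∀ i, c i ≠ x) → SuccLike col c x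
  · exact ⟨c, h, rfl, rfl, hall⟩
  push Not at hall
  obtain ⟨y, hy, hyN⟩ := hall
  have hyP := (tri y hy).resolve_left hyN
  refine ⟨fun i => c (-i), h.reverse hsym, by simp, ?_, fun x hx => ?_⟩
  · exact (neg_surjective (G := ℤ)).range_comp c
  · have hx' : ∀ i, c i ≠ x := fun i => by simpa using hx (-i)
    refine PredLike.reverse ((tri x hx').resolve_left fun hxN => ?_)
    exact h.not_succLike_predLike hsym hmono hL hno hx' hy hxN hyP

end IsPCRound

/-- The chord from `c i` to `c (i + r)` avoids the colors of the outgoing edges of its ends. -/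
def IsFreeChord (col : V → V → ℕ) (c : ℤ → V) (r i : ℤ) : Prop :=
  col (c i) (c (i + r)) ≠ col (c i) (c (i + 1)) ∧
    col (c i) (c (i + r)) ≠ col (c (i + r)) (c (i + r + 1))

namespace IsPCRound

variable {L : ℤ} {c : ℤ → V} {x y : V} {r i : ℤ}

lemma shift_congr (h : IsPCRound col L c) {i j : ℤ} (hij : c i = c j) (s : ℤ) :
    c (i + s) = c (j + s) := by
  rw [h.eq_iff] at hij ⊢
  convert hij using 1; ring

lemma exists_isFreeChord (hsym : ∀ u v, col u v = col v u)
    (hdeg : ∀ S, DegenSet col S → S = Set.univ) (h : IsPCRound col L c) (hL : 3 ≤ L)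
    (hx : ∀ i, c i ≠ x) (hN : ∀ x, (∀ i, c i ≠ x) → SuccLike col c x) :
    ∃ r i, 2 ≤ r ∧ r + 2 ≤ L ∧ IsFreeChord col c r i := by
  by_contra! hfree
  have hS := hdeg (Set.range c) ⟨⟨c 0, 0, rfl⟩, fun u => col u x, ?_, ?_⟩
  · obtain ⟨i, hi⟩ : x ∈ Set.range c := hS ▸ Set.mem_univ x
    exact hx i hi
  · rintro _ ⟨i, rfl⟩ _ ⟨j, rfl⟩ hij
    obtain ⟨k, hk1, hk2, hk⟩ := h.exists_index (by omega) i j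
    rw [← hk] at hij ⊢
    simp only [hN x hx _]
    rcases (by omega : k = i ∨ k = i + 1 ∨ k + 1 = i + L ∨ (2 ≤ k - i ∧ k - i + 2 ≤ L))
      with rfl | rfl | hkL | ⟨h1, h2⟩
    · exact absurd rfl hij
    · exact .inl rfl
    · right
      rw [hkL, h.periodic, hsym]
    · have := hfree _ i h1 h2
      rw [IsFreeChord, add_sub_cancel] at this
      tauto
  · rintro _ ⟨i, rfl⟩ y hy
    simp only [hN x hx i]
    exact hN y (fun i hi => hy ⟨i, hi⟩) i

lemma eq_pred_of_isFreeChord (hsym : ∀ u v, col u v = col v u) (h : IsPCRound col L c)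
    (hno : NoRound col (L + 1) (c 0)) (hx : ∀ i, c i ≠ x) (hN : SuccLike col c x)
    (hr : 2 ≤ r) (hrL : r + 2 ≤ L) (hf : IsFreeChord col c r i) :
    col (c (i + r - 1)) (c (i + r)) = col (c (i - 1)) (c i) := by
  by_contra hne
  have hpath := h.crossPath hsym (p := r - 1) (by omega) (by omega) hf.1 hf.2
  rw [show r - 1 + 1 + (L - r) = L by ring] at hpath
  have q0 : (if (0 : ℤ) ≤ r - 1 then c (i + (r - 1) - 0)
      else c (i + r + (0 - (r - 1) - 1))) = c (i + r - 1) := by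
    rw [if_pos (by omega)]; congr 1; ring
  have q1 : (if (1 : ℤ) ≤ r - 1 then c (i + (r - 1) - 1)
      else c (i + r + (1 - (r - 1) - 1))) = c (i + r - 1 - 1) := by
    rw [if_pos (by omega)]; congr 1; ring
  have q2 : (if L - 1 ≤ r - 1 then c (i + (r - 1) - (L - 1))
      else c (i + r + (L - 1 - (r - 1) - 1))) = c (i - 1) := by
    rw [if_neg (by omega), ← h.periodic (i - 1)]; congr 1; ring
  have q3 : (if L - 2 ≤ r - 1 then c (i + (r - 1) - (L - 2))
      else c (i + r + (L - 2 - (r - 1) - 1))) = c (i - 1 - 1) := by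
    rw [if_neg (by omega), ← h.periodic (i - 1 - 1)]; congr 1; ring
  obtain ⟨c', hc', hcq, -⟩ := hpath.exists_round_one (x := x) (by omega)
    (by intro k _ _; split_ifs <;> exact hx _)
    (by
      simp only [q2, q3]
      rw [hN, hsym]; exact h.pc_pred hsym (i - 1))
    (by
      simp only [q2, q0]
      rw [hsym x, hN, hN, sub_add_cancel, sub_add_cancel]; exact Ne.symm hne)
    (by
      simp only [q0, q1]
      rw [hsym x, hN]
      exact (h.pc_pred hsym (i + r - 1)).symm)
  obtain ⟨k, hk1, hk2, hk⟩ := h.exists_index (by omega : 0 < L) i 0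
  by_cases hkr : k ≤ i + (r - 1)
  · refine hno c' hc' (i + (r - 1) - k) ?_
    rw [hcq _ (by omega) (by omega), if_pos (by omega), ← hk]
    congr 1; ring
  · refine hno c' hc' (k - i) ?_
    rw [hcq _ (by omega) (by omega), if_neg (by omega), ← hk]
    congr 1; ring

lemma isFreeChord_all (hsym : ∀ u v, col u v = col v u) (hmono : ¬ HasMonoTriangle col)
    (h : IsPCRound col L c) (hno : NoRound col (L + 1) (c 0)) (hx : ∀ i, c i ≠ x)
    (hN : SuccLike col c x) (hr : 2 ≤ r) (hrL : r + 2 ≤ L) (hf : IsFreeChord col c r i) (j : ℤ) :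
    IsFreeChord col c r j := by
  have step : ∀ i, IsFreeChord col c r i → IsFreeChord col c r (i - 1) := by
    intro i hi
    have he := h.eq_pred_of_isFreeChord hsym hno hx hN hr hrL hi
    have hne : col (c (i - 1)) (c (i - 1 + r)) ≠ col (c (i - 1)) (c i) := by
      intro he'
      refine HasMonoTriangle.elim hmono (h.ne (by omega) (by omega)) (hx (i - 1 + r)) (hx (i - 1))
        he' ?_ ?_
      · rw [hN, ← he, show i - 1 + r = i + r - 1 by ring, sub_add_cancel]
      · rw [hN, sub_add_cancel]
    refine ⟨by rwa [sub_add_cancel], ?_⟩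
    rwa [show i - 1 + r + 1 = i + r by ring, show c (i - 1 + r) = c (i + r - 1) by ring_nf, he,
      ← show c (i - 1 + r) = c (i + r - 1) by ring_nf]
  obtain ⟨k, -, hk2, hk⟩ := h.exists_index (by omega : 0 < L) (i - L + 1) j
  have hfk : IsFreeChord col c r k :=
    Int.leInductionDown (m := i) (motive := fun k _ => IsFreeChord col c r k) hf
      (fun k _ => step k) k (by omega)
  have e1 := h.shift_congr hk r
  have e2 := h.shift_congr hk 1
  have e3 := h.shift_congr e1 1
  rwa [IsFreeChord, hk, e1, e2, e3] at hfk

lemma periodic_of_isFreeChord (hsym : ∀ u v, col u v = col v u) (h : IsPCRound col L c)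
    (hno : NoRound col (L + 1) (c 0)) (hx : ∀ i, c i ≠ x) (hN : SuccLike col c x)
    (hr : 2 ≤ r) (hrL : r + 2 ≤ L) (hf : ∀ i, IsFreeChord col c r i) (i : ℤ) :
    col (c (i + r)) (c (i + r + 1)) = col (c i) (c (i + 1)) := by
  have := h.eq_pred_of_isFreeChord hsym hno hx hN hr hrL (hf (i + 1))
  rwa [show i + 1 + r - 1 = i + r by ring, show i + 1 + r = i + r + 1 by ring,
    add_sub_cancel_right] at this

lemma eq_of_isFreeChord (hsym : ∀ u v, col u v = col v u) (hmono : ¬ HasMonoTriangle col)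
    (h : IsPCRound col L c) (hno : NoRound col (L + 1) (c 0))
    (hx : ∀ i, c i ≠ x) (hy : ∀ i, c i ≠ y) (hNx : SuccLike col c x) (hNy : SuccLike col c y)
    (hr : 2 ≤ r) (hrL : r + 2 ≤ L) (hf : ∀ i, IsFreeChord col c r i) : x = y := by
  by_contra hxy
  have hd : ∀ i, col (c i) (c (i + 1)) ≠ col x y := fun i he =>
    HasMonoTriangle.elim hmono (hx i) hxy (hy i) ((hNx i).trans he) rfl ((hNy i).trans he)
  have hpath := h.crossPath hsym (p := r - 2) (by omega) (by omega) (hf (2 - r)).1 (hf (2 - r)).2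
  rw [show r - 2 + 1 + (L - r) = L - 1 by ring] at hpath
  have q0 : (if (0 : ℤ) ≤ r - 2 then c (2 - r + (r - 2) - 0)
      else c (2 - r + r + (0 - (r - 2) - 1))) = c 0 := by
    rw [if_pos (by omega)]; congr 1; ring
  have q2 : (if L - 1 - 1 ≤ r - 2 then c (2 - r + (r - 2) - (L - 1 - 1))
      else c (2 - r + r + (L - 1 - 1 - (r - 2) - 1))) = c (1 - r) := by
    rw [if_neg (by omega), ← h.periodic (1 - r)]; congr 1; ring
  have q3 : (if L - 1 - 2 ≤ r - 2 then c (2 - r + (r - 2) - (L - 1 - 2))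
      else c (2 - r + r + (L - 1 - 2 - (r - 2) - 1))) = c (1 - r - 1) := by
    rw [if_neg (by omega), ← h.periodic (1 - r - 1)]; congr 1; ring
  obtain ⟨c', hc', hcq, -⟩ := hpath.exists_round_two (by omega) hxy
    (by intro k _ _; split_ifs <;> exact hx _)
    (by intro k _ _; split_ifs <;> exact hy _)
    (by
      simp only [q2, q3]
      rw [hNx, hsym]; exact h.pc_pred hsym (1 - r))
    (by
      simp only [q2]
      rw [hNx]; exact hd _)
    (by
      simp only [q0]
      rw [hsym y, hNy]; exact (hd _).symm)
    (by
      simp only [q0]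
      rw [hsym y, hNy]
      split_ifs with h1
      · rw [show 2 - r + (r - 2) - 1 = 0 - 1 by ring]
        exact (h.pc_pred hsym 0).symm
      · obtain rfl : r = 2 := by omega
        exact (hf 0).1.symm)
  refine hno c' (by rwa [show L + 1 = L - 1 + 2 by ring]) 0 ?_
  rw [hcq 0 (by omega) (by omega), q0]

/-- Replacing `c (i + r - 1)` by `x` with the help of a free chord forces the colors that
`c (i + r - 1)` sees. -/
lemma colors_of_isFreeChord (hsym : ∀ u v, col u v = col v u) (hmono : ¬ HasMonoTriangle col)
    (h : IsPCRound col L c) (hno : NoRound col (L + 1) (c 0)) (hx : ∀ i, c i ≠ x)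
    (hN : SuccLike col c x) (hr : 2 ≤ r) (hrL : r + 2 ≤ L) (hf : ∀ i, IsFreeChord col c r i)
    (hi : 0 < i + r - 1) (hiL : i + r - 1 < L) :
    col (c i) (c (i + r)) = col (c (i + r - 1)) (c (i + r)) ∧
      ∀ k, i + r < k → k < i + L → col (c k) (c (i + r - 1)) = col (c k) (c (k - 1)) := by
  have hpath := h.crossPath hsym (p := r - 2) (by omega) (by omega) (hf i).1 (hf i).2
  rw [show r - 2 + 1 + (L - r) = L - 1 by ring] at hpath
  have q0 : (if (0 : ℤ) ≤ r - 2 then c (i + (r - 2) - 0)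
      else c (i + r + (0 - (r - 2) - 1))) = c (i + r - 2) := by
    rw [if_pos (by omega)]; congr 1; ring
  have q2 : (if L - 1 - 1 ≤ r - 2 then c (i + (r - 2) - (L - 1 - 1))
      else c (i + r + (L - 1 - 1 - (r - 2) - 1))) = c (i - 1) := by
    rw [if_neg (by omega), ← h.periodic (i - 1)]; congr 1; ring
  have q3 : (if L - 1 - 2 ≤ r - 2 then c (i + (r - 2) - (L - 1 - 2))
      else c (i + r + (L - 1 - 2 - (r - 2) - 1))) = c (i - 1 - 1) := by
    rw [if_neg (by omega), ← h.periodic (i - 1 - 1)]; congr 1; ring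
  have hper := h.periodic_of_isFreeChord hsym hno hx hN hr hrL hf
  obtain ⟨c', hc', hcq, hcx⟩ := hpath.exists_round_one (x := x) (by omega)
    (by intro k _ _; split_ifs <;> exact hx _)
    (by
      simp only [q2, q3]
      rw [hN, hsym]; exact h.pc_pred hsym (i - 1))
    (by
      simp only [q2, q0]
      rw [hsym x, hN, hN, ← hper (i - 1)]
      have := h.pc (i + r - 2)
      convert this.symm using 3 <;> ring_nf)
    (by
      simp only [q0]
      rw [hsym x, hN]
      split_ifs with h1
      · have := h.pc_pred hsym (i + r - 2)
        convert this.symm using 3 ; ring_nf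
      · obtain rfl : r = 2 := by omega
        have := (hf i).1.symm
        convert this using 3 <;> ring_nf)
  rw [sub_add_cancel] at hc'
  have hlow : ∀ k, 0 ≤ k → k ≤ r - 2 → c' k = c (i + (r - 2) - k) := fun k h1 h2 => by
    rw [hcq k h1 (by omega), if_pos h2]
  have hhigh : ∀ k, r - 2 < k → k < L - 1 → c' k = c (i + k + 1) := fun k h1 h2 => by
    rw [hcq k (by omega) (by omega), if_neg (by omega)]; congr 1; ring
  have hw : ∀ j, c' j ≠ c (i + r - 1) := by
    refine hc'.forall_of_forall_range (by omega) (p := fun u => u ≠ c (i + r - 1))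
      fun j hj hjL => ?_
    rcases (by omega : j ≤ r - 2 ∨ (r - 2 < j ∧ j < L - 1) ∨ j = L - 1) with h1 | ⟨h1, h2⟩ | rfl
    · rw [hlow j hj h1]
      exact h.ne (by omega) (by omega)
    · rw [hhigh j h1 h2]
      exact (h.ne (by omega) (by omega)).symm
    · rw [hcx]; exact (hx _).symm
  obtain ⟨i₀, hv⟩ : ∃ i₀, c' i₀ = c 0 := by
    obtain ⟨k, hk1, hk2, hk⟩ := h.exists_index (by omega : 0 < L) i 0
    have hk' : k ≠ i + r - 1 := by
      rintro rfl
      exact h.ne hi (by omega) hk.symm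
    by_cases hkr : k ≤ i + (r - 2)
    · refine ⟨i + (r - 2) - k, ?_⟩
      rw [hlow _ (by omega) (by omega), ← hk]
      congr 1; ring
    · refine ⟨k - i - 1, ?_⟩
      rw [hhigh _ (by omega) (by omega), ← hk]
      congr 1; ring
  have s0 : c' 0 = c (i + r - 2) := by
    rw [hlow _ (by omega) (by omega)]; congr 1; ring
  have s1 : c' (r - 1) = c (i + r) := by
    rw [hhigh _ (by omega) (by omega)]; congr 1; ring
  have s2 : c' (r - 1 + 1) = c (i + r + 1) := by
    rw [hhigh _ (by omega) (by omega)]; congr 1; ring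
  have s3 : c' (r - 1 - 1) = c i := by
    rw [hlow _ (by omega) (by omega)]; congr 1; ring
  rcases hc'.trichotomy hsym hmono (by omega) hno hv hw with hT | hT | ⟨e, hT⟩
  · have h1 := hT (r - 1)
    rw [s1, s2] at h1
    exact absurd h1 (h.pc_pred hsym (i + r))
  · constructor
    · have h1 := hT (r - 1)
      rw [s1, s3] at h1
      rw [hsym, ← h1, hsym]
    · intro k hk hkL
      have h1 := hT (k - i - 1)
      rw [hhigh _ (by omega) (by omega), hhigh _ (by omega) (by omega)] at h1
      convert h1 using 3 <;> ring_nf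
  · have h1 := (hT 0).1.trans (hT (r - 1)).1.symm
    rw [s0, s1, hsym (c (i + r))] at h1
    have := h.pc (i + r - 2)
    rw [show i + r - 2 + 1 = i + r - 1 by ring, sub_add_cancel] at this
    exact absurd h1 this

/-- If a round cannot be extended, the whole graph is a `K₅` made of two monochromatic
pentagons. -/
lemma exists_pentagons (hsym : ∀ u v, col u v = col v u) (hmono : ¬ HasMonoTriangle col)
    (hdeg : ∀ S, DegenSet col S → S = Set.univ) (h : IsPCRound col L c) (hL : 3 ≤ L)
    (hno : NoRound col (L + 1) (c 0)) (hx : ∀ i, c i ≠ x)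
    (hN : ∀ x, (∀ i, c i ≠ x) → SuccLike col c x) :
    ∃ e : ZMod 5 → V, Function.Bijective e ∧
      ∃ a b : ℕ, a ≠ b ∧ (∀ i, col (e i) (e (i + 1)) = a) ∧
        (∀ i, col (e i) (e (i + 2)) = b) := by
  have hNx := hN x hx
  obtain ⟨r, i, hr, hrL, hf⟩ := h.exists_isFreeChord hsym hdeg hL hx hN
  replace hf := h.isFreeChord_all hsym hmono hno hx hNx hr hrL hf
  have hf2 : ∀ i, IsFreeChord col c 2 i := by
    have h1 := (h.colors_of_isFreeChord hsym hmono hno hx hNx hr hrL hf (i := 2 - r)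
      (by omega) (by omega)).2 3 (by omega) (by omega)
    rw [show 2 - r + r - 1 = 1 by ring, hsym, hsym (c 3), show (3 : ℤ) - 1 = 2 by norm_num] at h1
    refine h.isFreeChord_all hsym hmono hno hx hNx le_rfl (by omega) (i := 1) ?_
    rw [IsFreeChord, show (1 : ℤ) + 2 = 3 by norm_num, h1]
    exact ⟨(h.pc 1).symm, h.pc 2⟩
  have hL4 : 4 ≤ L := by omega
  have hper := h.periodic_of_isFreeChord hsym hno hx hNx le_rfl hL4 hf2
  have hcol := fun i => h.colors_of_isFreeChord (i := i) hsym hmono hno hx hNx le_rfl hL4 hf2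
  have p1 := hper 0
  have p2 := hper 1
  have p3 := hper 2
  have hc02 := (hcol 0 (by omega) (by omega)).1
  have hc13 := (hcol 1 (by omega) (by omega)).1
  have h01 := h.pc 0
  norm_num at p1 p2 p3 hc02 hc13 h01
  rcases (by omega : L = 4 ∨ L = 5 ∨ 6 ≤ L) with rfl | rfl | hL6
  · have e4 : c 4 = c 0 := h.periodic 0
    rw [e4] at p2
    have n0 := hNx 0
    have n1 := hNx 1
    have n2 := hNx 2
    have n3 := hNx 3
    norm_num at n0 n1 n2 n3
    rw [e4] at n3
    rw [p1] at hc13 n2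
    rw [p2] at n3
    have d01 : c 0 ≠ c 1 := h.ne (by omega) (by omega)
    have d02 : c 0 ≠ c 2 := h.ne (by omega) (by omega)
    have d03 : c 0 ≠ c 3 := h.ne (by omega) (by omega)
    have d12 : c 1 ≠ c 2 := h.ne (by omega) (by omega)
    have d13 : c 1 ≠ c 3 := h.ne (by omega) (by omega)
    have d23 : c 2 ≠ c 3 := h.ne (by omega) (by omega)
    refine ⟨(![x, c 0, c 1, c 3, c 2] : Fin 5 → V), ⟨?_, ?_⟩, col (c 0) (c 1), col (c 1) (c 2),
      h01, ?_, ?_⟩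
    · change Function.Injective (![x, c 0, c 1, c 3, c 2] : Fin 5 → V)
      refine .of_lt_imp_ne fun i j hij => ?_
      fin_cases i <;> fin_cases j <;> first
        | exact absurd hij (by decide)
        | exact (hx _).symm
        | assumption
        | exact d02
        | exact d23.symm
    · intro z
      by_cases hz : ∃ i, c i = z
      · obtain ⟨i, rfl⟩ := hz
        refine h.forall_of_forall_range (by omega) (p := fun u => ∃ a, ![x, c 0, c 1, c 3, c 2] a = u)
          (fun i hi hi4 => ?_) i
        rcases (by omega : i = 0 ∨ i = 1 ∨ i = 2 ∨ i = 3) with rfl | rfl | rfl | rfl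
        exacts [⟨1, rfl⟩, ⟨2, rfl⟩, ⟨4, rfl⟩, ⟨3, rfl⟩]
      · push Not at hz
        exact ⟨(0 : Fin 5), h.eq_of_isFreeChord hsym hmono hno hx hz hNx (hN z hz) le_rfl hL4 hf2⟩
    · intro i
      change Fin 5 at i
      fin_cases i
      exacts [(hsym _ _).trans n0, rfl, hc13, (hsym _ _).trans p1, n2]
    · intro i
      change Fin 5 at i
      fin_cases i
      exacts [(hsym _ _).trans n1, (hsym _ _).trans p2, rfl, n3, (hsym _ _).trans hc02]
  · have e5 : c 5 = c 0 := h.periodic 0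
    have h40 := h.pc 4
    have e6 : c 6 = c 1 := h.periodic 1
    norm_num [e5, e6] at h40 p3
    exact absurd (p3.trans p1) h40
  · have hc35 := (hcol 3 (by omega) (by omega)).1
    have hc15 := (hcol 0 (by omega) (by omega)).2 5 (by omega) (by omega)
    norm_num at hc35 hc15
    refine (HasMonoTriangle.elim hmono (x := c 1) (y := c 3) (z := c 5)
      (h.ne (by omega) (by omega)) (h.ne (by omega) (by omega)) (h.ne (by omega) (by omega))
      hc13 (hc35.trans p3) ?_).elim
    rw [hsym, hc15, hsym, p3]

end IsPCRound

namespace IsPCRound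

variable {L : ℤ} {c : ℤ → V} {x v : V}

lemma exists_extension (hsym : ∀ u v, col u v = col v u) (hmono : ¬ HasMonoTriangle col)
    (hdeg : ∀ S, DegenSet col S → S = Set.univ) (h : IsPCRound col L c) (hL : 3 ≤ L)
    (hx : ∀ i, c i ≠ x) (hv : c 0 = v) :
    (∃ c', IsPCRound col (L + 1) c' ∧ c' 0 = v) ∨
    ∃ e : ZMod 5 → V, Function.Bijective e ∧
      ∃ a b : ℕ, a ≠ b ∧ (∀ i, col (e i) (e (i + 1)) = a) ∧
        (∀ i, col (e i) (e (i + 2)) = b) := by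
  by_cases hno : NoRound col (L + 1) v
  · subst hv
    obtain ⟨c', hc', h0, hrange, hN⟩ := h.exists_forall_succLike hsym hmono hdeg hL hno
    have hx' : ∀ i, c' i ≠ x := fun i hi => by
      have : x ∈ Set.range c := hrange ▸ ⟨i, hi⟩
      obtain ⟨j, hj⟩ := this
      exact hx j hj
    exact .inr (hc'.exists_pentagons hsym hmono hdeg hL (by rwa [h0]) hx' hN)
  · rw [NoRound] at hno
    push Not at hno
    obtain ⟨c', hc', i, hi⟩ := hno
    exact .inl ⟨_, hc'.shift i, by simpa using hi⟩

lemma exists_notMem_range [Fintype V] (h : IsPCRound col L c) (hL : 0 < L)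
    (hcard : L < Fintype.card V) : ∃ x, ∀ i, c i ≠ x := by
  classical
  by_contra! hall
  have hsub : (Finset.univ : Finset V) ⊆ (Finset.Ico 0 L).image c := by
    intro z _
    obtain ⟨i, hi⟩ := hall z
    obtain ⟨k, hk1, hk2, hk⟩ := h.exists_index hL 0 i
    exact Finset.mem_image.2 ⟨k, Finset.mem_Ico.2 ⟨hk1, by omega⟩, hk.trans hi⟩
  have := (Finset.card_le_card hsub).trans Finset.card_image_le
  rw [Finset.card_univ, Int.card_Ico] at this
  omega

end IsPCRound

lemma exists_round_three {v u w : V} (hvu : v ≠ u) (hvw : v ≠ w) (huw : u ≠ w)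
    (h1 : col v u ≠ col u w) (h2 : col u w ≠ col w v) (h3 : col w v ≠ col v u) :
    ∃ c, IsPCRound col 3 c ∧ c 0 = v := by
  obtain ⟨c, hc, hcq, -⟩ := (IsPCPath.pair (col := col) hvu).exists_round_one (x := w) (by omega)
    (by intro i _ _; split_ifs; exacts [huw, hvw]) (by simpa) (by simpa) (by simpa)
  exact ⟨c, hc, by rw [hcq 0 (by omega) (by omega)]; simp⟩

lemma exists_round_four {v u w z : V} (hvu : v ≠ u) (hvw : v ≠ w) (huw : u ≠ w) (hvz : v ≠ z)
    (huz : u ≠ z) (hwz : w ≠ z) (h1 : col v u ≠ col u w) (h2 : col u w ≠ col w z)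
    (h3 : col w z ≠ col z v) (h4 : col z v ≠ col v u) :
    ∃ c, IsPCRound col 4 c ∧ c 0 = v := by
  obtain ⟨c, hc, hcq, -⟩ := (IsPCPath.pair (col := col) hvu).exists_round_two (x := w) (y := z)
    (by omega) hwz (by intro i _ _; split_ifs; exacts [huw, hvw])
    (by intro i _ _; split_ifs; exacts [huz, hvz])
    (by simpa) (by simpa) (by simpa) (by simpa)
  exact ⟨c, hc, by rw [hcq 0 (by omega) (by omega)]; simp⟩

/-- Every vertex lies on a properly colored cycle of length three or four. -/
lemma exists_short_round (hsym : ∀ u v, col u v = col v u) (hmono : ¬ HasMonoTriangle col)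
    (hdeg : ∀ S, DegenSet col S → S = Set.univ) {v z : V} (hz : z ≠ v) :
    ∃ m : ℕ, 3 ≤ m ∧ m ≤ 4 ∧ ∃ c, IsPCRound col (m : ℤ) c ∧ c 0 = v := by
  by_contra! hno
  have htri : ∀ u w, u ≠ v → w ≠ v → u ≠ w → col v u ≠ col v w →
      col u w = col v u ∨ col u w = col v w := by
    intro u w hu hw huw huv
    by_contra! hc
    obtain ⟨c, hc, hcv⟩ := exists_round_three hu.symm hw.symm huw hc.1.symm
      (by rw [hsym w]; exact hc.2) (by rw [hsym w]; exact huv.symm)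
    exact hno 3 le_rfl (by omega) c hc hcv
  have hclass : ∀ u w z, u ≠ v → w ≠ v → z ≠ v → u ≠ w → col v u = col v w →
      col v z ≠ col v w → col w z = col v z := by
    intro u w z hu hw hz huw huv hzw
    have hwz : w ≠ z := by rintro rfl; exact hzw rfl
    have huz : u ≠ z := by rintro rfl; exact hzw huv
    rcases htri w z hw hz hwz hzw.symm with h1 | h1
    · by_contra h2
      have h3 : col u w ≠ col v u := fun h =>
        HasMonoTriangle.elim hmono hu.symm huw hw.symm rfl h huv.symm
      obtain ⟨c, hc, hcv⟩ := exists_round_four hu.symm hw.symm huw hz.symm huz hwz h3.symm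
        (by rwa [h1, ← huv]) (by rwa [hsym z]) (by rwa [hsym z, huv])
      exact hno 4 (by omega) le_rfl c hc hcv
    · exact h1
  by_cases hpair : ∃ u w, u ≠ v ∧ w ≠ v ∧ u ≠ w ∧ col v u = col v w
  · obtain ⟨u, w, hu, hw, huw, huv⟩ := hpair
    by_cases hne : ∃ z, z ≠ v ∧ col v z ≠ col v w
    · have := hdeg {z | z ≠ v ∧ col v z ≠ col v w} ⟨hne, fun z => col v z, ?_, ?_⟩
      · have hv : v ∈ {z | z ≠ v ∧ col v z ≠ col v w} := this ▸ Set.mem_univ v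
        exact hv.1 rfl
      · rintro y ⟨hy, hyw⟩ z ⟨hz, hzw⟩ hyz
        refine htri y z hy hz hyz fun he => ?_
        have h1 := hclass y z w hy hz hw hyz he (by rw [← he]; exact hyw.symm)
        have h2 := hclass u w z hu hw hz huw huv hzw
        exact hzw (by rw [← h2, hsym, h1])
      · rintro y ⟨hy, hyw⟩ z hz
        by_cases hzv : z = v
        · subst hzv; exact hsym _ _
        have hzw : col v z = col v w := by
          by_contra h
          exact hz ⟨hzv, h⟩
        rw [hsym]
        by_cases hzu : z = u
        · subst hzu
          exact hclass w z y hw hu hy huw.symm huv.symm (by rwa [huv])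
        · exact hclass u z y hu hzv hy (Ne.symm hzu) (huv.trans hzw.symm) (by rwa [hzw])
    · push Not at hne
      have := hdeg {v} ⟨⟨v, rfl⟩, fun _ => col v w, ?_, ?_⟩
      · exact hw (this ▸ Set.mem_univ w : w ∈ ({v} : Set V))
      · rintro _ rfl _ rfl h
        exact absurd rfl h
      · rintro _ rfl z hz
        exact hne z hz
  · push Not at hpair
    have := hdeg {v}ᶜ ⟨⟨z, hz⟩, fun z => col v z, ?_, ?_⟩
    · exact (this ▸ Set.mem_univ v : v ∈ ({v}ᶜ : Set V)) rfl
    · intro y hy z hz hyz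
      exact htri y z hy hz hyz (hpair y z hy hz hyz)
    · intro y hy z hz
      obtain rfl : z = v := by simpa using hz
      exact hsym _ _

end

/-- Main theorem: an edge-colored $K_n$ ($n ≥ 4$) with no monochromatic
triangle is vertex-pancyclic for PC cycles of lengths 4 to $n$, or has a
degenerate set $S ≠ V$, or is the $K_5$ of two edge-disjoint monochromatic
pentagons. -/
theorem main_vertex_pancyclic_trichotomy
    (n : ℕ) (hn : 4 ≤ n) (col : Fin n → Fin n → ℕ)
    (hsym : ∀ u v, col u v = col v u)
    (hmono : ¬ HasMonoTriangle col) :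
    (∀ v : Fin n, ∀ ℓ : ℕ, 4 ≤ ℓ → ℓ ≤ n → PCThrough col ℓ v) ∨
    (∃ S : Set (Fin n), DegenSet col S ∧ S ≠ Set.univ) ∨
    (n = 5 ∧ ∃ e : ZMod 5 → Fin n, Function.Bijective e ∧
      ∃ a b : ℕ, a ≠ b ∧ (∀ i, col (e i) (e (i + 1)) = a) ∧
        (∀ i, col (e i) (e (i + 2)) = b)) := by
  by_cases hdeg : ∃ S : Set (Fin n), DegenSet col S ∧ S ≠ Set.univ
  · exact .inr (.inl hdeg)
  have hdeg' : ∀ S, DegenSet col S → S = Set.univ := fun S hS => by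
    by_contra hne
    exact hdeg ⟨S, hS, hne⟩
  by_cases hpent : ∃ e : ZMod 5 → Fin n, Function.Bijective e ∧
      ∃ a b : ℕ, a ≠ b ∧ (∀ i, col (e i) (e (i + 1)) = a) ∧ (∀ i, col (e i) (e (i + 2)) = b)
  · refine .inr (.inr ⟨?_, hpent⟩)
    obtain ⟨e, he, -⟩ := hpent
    simpa using (Fintype.card_of_bijective he).symm
  refine .inl fun v ℓ hℓ hℓn => ?_
  obtain ⟨z, hz⟩ : ∃ z : Fin n, z ≠ v := by
    have : Nontrivial (Fin n) := Fin.nontrivial_iff_two_le.2 (by omega)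
    exact exists_ne v
  obtain ⟨m, hm, hm4, c₀, hc₀, hc₀v⟩ := exists_short_round hsym hmono hdeg' hz
  have key : ∃ c, IsPCRound col (ℓ : ℤ) c ∧ c 0 = v := by
    refine Nat.le_induction (m := m) (P := fun k _ => k ≤ n → ∃ c, IsPCRound col (k : ℤ) c ∧ c 0 = v)
      (fun _ => ⟨c₀, hc₀, hc₀v⟩) (fun k hk ih hkn => ?_) ℓ (by omega) hℓn
    obtain ⟨c, hc, hcv⟩ := ih (by omega)
    obtain ⟨x, hx⟩ := hc.exists_notMem_range (by omega) (by simpa using hkn)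
    push_cast
    exact (hc.exists_extension hsym hmono hdeg' (by omega) hx hcv).resolve_right hpent
  obtain ⟨c, hc, rfl⟩ := key
  exact hc.pcThrough 0
end
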